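/- For γ ∈ (0,1) let T_γ be the LSV map T_γ(x) = x(1 + 2^γ x^γ) for 0 ≤ x ≤ 1/2 and 2x − 1 for 1/2 < x ≤ 1. Fix γ_1,…,γ_m ∈ (0,1) with γ_max := max_i γ_i < 1/3, T_i := T_{γ_i}, Ω := {1,…,m}^ℤ with Bernoulli measure 𝐏 := (p_1,…,p_m)^{⊗ℤ} (all p_i > 0) and left shift σ, T_ω^n := T_{ω_{n−1}} ∘ ⋯ ∘ T_{ω_0}, and m Lebesgue measure on [0,1]. Assume (ν^ω)_{ω∈Ω} is a family of Borel probability measures on [0,1] with densities h_ω := dν^ω/dm such that: (i) (T_{ω_0})_* ν^ω = ν^{σω} for all ω; (ii) each h_ω lies in the cone L, i.e., h_ω is continuous on (0,1], non-negative, non-increasing, x ↦ x^{γ_max+1} h_ω(x) is increasing, and h_ω(x) ≤ a x^{−γ_max} for a fixed constant a; (iii) ‖(T^n_{σ^{−n}ω})_* m − ν^ω‖ ≤ C n^{1−1/γ_max} (log n)^{1/γ_max} in total variation, for all ω and n; (iv) for every C¹ function g on [0,1], all ω and all N ≥ 1: ‖(T_ω^N)_*( (g − ∫ g dν^ω) ·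 ν^ω )‖ ≤ C ‖g‖_{C¹} N^{1−1/γ_max} (log N)^{1/γ_max} in total variation. Fix α ∈ (0,2). Then for m-a.e. x0 ∈ [0,1], with φ(x) := |x − x0|^{−1/α}, b := lim_{ε→0⁺} ε^{−1} ν({x : |x−x0| < ε}) (which exists and is positive, where ν := ∫_Ω ν^ω d𝐏), b_n := (bn)^{1/α}, J = ⋃_{i=1}^q (u_i, v_i] with 0 < u_i < v_i ≤ ∞, Π_α(J) := Σ_i (u_i^{−α} − v_i^{−α}), and A_n := { x : φ(x)/b_n ∈ J }, the following holds for 𝐏-a.e. ω and all 0 ≤ s < t: lim_{n→∞} ν^{σ^{⌊ns⌋} ω}( { x : R_{A_n}(σ^{⌊ns⌋} ω)(x) > ⌊n(t−s)⌋ } ) = e^{−(t−s) Π_α(J)}, where R_U(ω)(x) := inf{ k ≥ 1 : T_ω^k(x) ∈ U }. -/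

import Mathlib

open MeasureTheory Filter Set Topology ENNReal

noncomputable section

/-- The two-sided shift space on `m` symbols. -/
abbrev Om (m : ℕ) := ℤ → Fin m

/-- The left shift on the two-sided shift space. -/
def shift {m : ℕ} (ω : Om m) : Om m := fun i => ω (i + 1)

/-- The inverse of the left shift. -/
def shiftInv {m : ℕ} (ω : Om m) : Om m := fun i => ω (i - 1)

/-- Lebesgue measure on `[0,1]`. -/
def mLeb : Measure ℝ := volume.restrict (Set.Icc 0 1)

/-- The Liverani–Saussol–Vaienti intermittent map with parameter `γ`. -/
def lsv (γ : ℝ) (x : ℝ) : ℝ :=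
  if x ≤ 1 / 2 then x * (1 + 2 ^ γ * x ^ γ) else 2 * x - 1

/-- The random composition `T_ω^n = T_{ω_{n−1}} ∘ ⋯ ∘ T_{ω_0}`. -/
def randComp {m : ℕ} (T : Fin m → ℝ → ℝ) (ω : Om m) : ℕ → ℝ → ℝ
  | 0 => fun x => x
  | n + 1 => fun x => T (ω (n : ℤ)) (randComp T ω n x)

/-- The total variation distance `‖μ − ν‖` of two (finite) measures, via the
Hahn–Jordan description `‖μ − ν‖ = sup_A (μ(A) − ν(A)) + sup_A (ν(A) − μ(A))`. -/
def tvDist (μ ν : Measure ℝ) : ℝ :=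
  (⨆ A : {A : Set ℝ // MeasurableSet A}, ((μ A).toReal - (ν A).toReal)) +
  (⨆ A : {A : Set ℝ // MeasurableSet A}, ((ν A).toReal - (μ A).toReal))

/-- The `C¹` norm of `g` on `[0,1]`. -/
def C1norm (g : ℝ → ℝ) : ℝ :=
  (⨆ x : Set.Icc (0 : ℝ) 1, |g x|) + (⨆ x : Set.Icc (0 : ℝ) 1, |deriv g x|)

/-- The observable `φ(x) = |x − x0|^{−1/α}`. -/
def phiObs (α x0 x : ℝ) : ℝ := |x - x0| ^ (-α⁻¹)

/-- Membership in `J = ⋃_i (u_i, v_i]` (with `v_i = ∞` allowed). -/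
def memJ {q : ℕ} (u : Fin q → ℝ) (v : Fin q → ℝ≥0∞) (y : ℝ) : Prop :=
  ∃ i, u i < y ∧ ENNReal.ofReal y ≤ v i

/-- `Π_α(J) = Σ_i (u_i^{−α} − v_i^{−α})`. -/
def PiAlpha (α : ℝ) {q : ℕ} (u : Fin q → ℝ) (v : Fin q → ℝ≥0∞) : ℝ :=
  ∑ i, ((u i) ^ (-α) - ((v i).toReal) ^ (-α))

/-- The set `A_n = φ^{−1}(b_n J) = {x : φ(x)/b_n ∈ J}`. -/
def Aset (α x0 bn : ℝ) {q : ℕ} (u : Fin q → ℝ) (v : Fin q → ℝ≥0∞) : Set ℝ :=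
  {x | memJ u v (phiObs α x0 x / bn)}

/-- The survival event `{x : R_A(ω)(x) > N}`. -/
def survSet {m : ℕ} (T : Fin m → ℝ → ℝ) (ω : Om m) (A : Set ℝ) (N : ℕ) : Set ℝ :=
  {x | ∀ k : ℕ, 1 ≤ k → k ≤ N → randComp T ω k x ∉ A}



/-- the derivative of the LSV map -/
def dlsv (γ : ℝ) (x : ℝ) : ℝ :=
  if x ≤ 1 / 2 then 1 + (1 + γ) * (2 ^ γ * x ^ γ) else 2

lemma two_mul_rpow {γ x : ℝ} (hx : 0 ≤ x) : (2:ℝ) ^ γ * x ^ γ = (2 * x) ^ γ :=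
  (Real.mul_rpow (by norm_num) hx).symm

lemma lsv_left {γ x : ℝ} (hx0 : 0 ≤ x) (hx : x ≤ 1 / 2) : lsv γ x = x * (1 + (2 * x) ^ γ) := by
  rw [lsv, if_pos hx, two_mul_rpow hx0]

lemma lsv_right {γ x : ℝ} (hx : 1 / 2 < x) : lsv γ x = 2 * x - 1 := by
  rw [lsv, if_neg (not_le.2 hx)]

lemma dlsv_left {γ x : ℝ} (hx0 : 0 ≤ x) (hx : x ≤ 1 / 2) :
    dlsv γ x = 1 + (1 + γ) * (2 * x) ^ γ := by
  rw [dlsv, if_pos hx, two_mul_rpow hx0]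

lemma dlsv_right {γ x : ℝ} (hx : 1 / 2 < x) : dlsv γ x = 2 := by
  rw [dlsv, if_neg (not_le.2 hx)]

lemma measurable_lsv (γ : ℝ) : Measurable (lsv γ) := by
  unfold lsv
  refine Measurable.ite measurableSet_Iic ?_ ?_ <;> fun_prop

lemma dlsv_ge_one {γ x : ℝ} (hγ : 0 < γ) (hx : 0 ≤ x) : 1 ≤ dlsv γ x := by
  unfold dlsv
  split_ifs
  · have : 0 ≤ (1 + γ) * (2 ^ γ * x ^ γ) := by positivity
    linarith
  · norm_num

lemma lsv_mem {γ x : ℝ} (hγ : 0 < γ) (hx : x ∈ Ioc (0:ℝ) 1) : lsv γ x ∈ Ioc (0:ℝ) 1 := by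
  obtain ⟨h0, h1⟩ := hx
  by_cases h : x ≤ 1 / 2
  · rw [lsv_left h0.le h]
    have h2 : (2 * x) ^ γ ≤ 1 := Real.rpow_le_one (by linarith) (by linarith) hγ.le
    have h3 : 0 ≤ (2 * x) ^ γ := by positivity
    constructor
    · positivity
    · nlinarith
  · rw [lsv_right (not_le.1 h)]
    constructor <;> linarith [not_le.1 h]

lemma lsv_mem_Icc {γ x : ℝ} (hγ : 0 < γ) (hx : x ∈ Icc (0:ℝ) 1) : lsv γ x ∈ Icc (0:ℝ) 1 := by
  rcases eq_or_lt_of_le hx.1 with h | h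
  · subst h; rw [lsv_left le_rfl (by norm_num)]; simp
  · exact Ioc_subset_Icc_self (lsv_mem hγ ⟨h, hx.2⟩)

/-- mean value bounds for the power function -/
lemma rpow_mv {γ z w : ℝ} (hγ : 0 < γ) (hz : 0 < z) (hzw : z ≤ w) :
    (1 + γ) * z ^ γ * (w - z) ≤ w ^ (1 + γ) - z ^ (1 + γ) ∧
    w ^ (1 + γ) - z ^ (1 + γ) ≤ (1 + γ) * w ^ γ * (w - z) := by
  have key : ∀ a b : ℝ, 0 < a → 0 < b → b ^ (1 + γ) ≥ a ^ (1 + γ) + (1 + γ) * a ^ γ * (b - a) := by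
    intro a b ha hb
    have h1 := one_add_mul_self_le_rpow_one_add (s := b / a - 1) (by
      have : 0 < b / a := by positivity
      linarith) (p := 1 + γ) (by linarith)
    have h2 : (1 + (b / a - 1)) = b / a := by ring
    rw [h2, Real.div_rpow hb.le ha.le] at h1
    have h3 : 0 < a ^ (1 + γ) := by positivity
    rw [le_div_iff₀ h3] at h1
    have h4 : a ^ (1 + γ) = a * a ^ γ := by rw [Real.rpow_add ha, Real.rpow_one]
    have h5 : (1 + (1 + γ) * (b / a - 1)) * a ^ (1 + γ)
        = a ^ (1 + γ) + (1 + γ) * a ^ γ * (b - a) := by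
      rw [h4]; field_simp
    linarith
  have hw : 0 < w := hz.trans_le hzw
  have h1 := key z w hz hw
  have h2 := key w z hw hz
  constructor <;> nlinarith

lemma lsv_mv_left {γ z w : ℝ} (hγ : 0 < γ) (hz : 0 < z) (hzw : z ≤ w) (hw : w ≤ 1 / 2) :
    dlsv γ z * (w - z) ≤ lsv γ w - lsv γ z ∧ lsv γ w - lsv γ z ≤ dlsv γ w * (w - z) := by
  have hw0 : 0 < w := hz.trans_le hzw
  rw [lsv_left hz.le (hzw.trans hw), lsv_left hw0.le hw, dlsv_left hz.le (hzw.trans hw),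
    dlsv_left hw0.le hw]
  have h := rpow_mv hγ (z := 2 * z) (w := 2 * w) (by linarith) (by linarith)
  rw [Real.rpow_add (by linarith), Real.rpow_add (by linarith), Real.rpow_one, Real.rpow_one] at h
  constructor <;> nlinarith [h.1, h.2]

lemma lsv_mv_right {γ z w : ℝ} (hz : 1 / 2 < z) (hzw : z ≤ w) :
    dlsv γ z * (w - z) ≤ lsv γ w - lsv γ z ∧ lsv γ w - lsv γ z ≤ dlsv γ w * (w - z) := by
  rw [lsv_right hz, lsv_right (hz.trans_le hzw), dlsv_right hz, dlsv_right (hz.trans_le hzw)]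
  constructor <;> linarith

lemma dlsv_mono_left {γ z w : ℝ} (hγ : 0 < γ) (hz : 0 < z) (hzw : z ≤ w) (hw : w ≤ 1 / 2) :
    dlsv γ z ≤ dlsv γ w := by
  have hw0 : 0 < w := hz.trans_le hzw
  rw [dlsv_left hz.le (hzw.trans hw), dlsv_left hw0.le hw]
  gcongr

/-- `u ↦ (1+u)^(1+g) / (1 + (1+γ) u)` is nondecreasing for `γ ≤ g` -/
lemma cone_aux {γ g s t : ℝ} (hγ : 0 < γ) (hg : γ ≤ g) (hs : 0 ≤ s) (hst : s ≤ t) :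
    (1 + s) ^ (1 + g) * (1 + (1 + γ) * t) ≤ (1 + t) ^ (1 + g) * (1 + (1 + γ) * s) := by
  have ht : 0 ≤ t := hs.trans hst
  have h1 := one_add_mul_self_le_rpow_one_add (s := (1 + t) / (1 + s) - 1) (by
      have : 0 < (1 + t) / (1 + s) := by positivity
      linarith) (p := 1 + g) (by linarith)
  have h2 : (1 + ((1 + t) / (1 + s) - 1)) = (1 + t) / (1 + s) := by ring
  rw [h2, Real.div_rpow (by linarith) (by linarith)] at h1
  have h3 : 0 < (1 + s) ^ (1 + g) := by positivity
  rw [le_div_iff₀ h3] at h1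
  have h4 : (1 + (1 + γ) * t) ≤ (1 + (1 + g) * ((1 + t) / (1 + s) - 1)) * (1 + (1 + γ) * s) := by
    have h5 : (1 + t) / (1 + s) - 1 = (t - s) / (1 + s) := by field_simp; ring
    rw [h5]
    have h6 : (1 + (1 + γ) * t) = (1 + (1 + γ) * s) + (1 + γ) * (t - s) := by ring
    have h7 : (1 + γ) * (t - s) ≤ (1 + g) * ((t - s) / (1 + s)) * (1 + (1 + γ) * s) := by
      have h8 : (1 + g) * ((t - s) / (1 + s)) * (1 + (1 + γ) * s)
        = ((1 + g) * (1 + (1 + γ) * s) * (t - s)) / (1 + s) := by ring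
      rw [h8, le_div_iff₀ (by linarith)]
      have h9 : (1 + γ) * (1 + s) ≤ (1 + g) * (1 + (1 + γ) * s) := by
        have : (1 + s) ≤ 1 + (1 + γ) * s := by nlinarith
        apply mul_le_mul <;> linarith
      nlinarith [mul_le_mul_of_nonneg_right h9 (sub_nonneg.2 hst)]
    linarith
  have h10 : 0 < 1 + (1 + γ) * s := by positivity
  calc (1 + s) ^ (1 + g) * (1 + (1 + γ) * t)
      ≤ (1 + s) ^ (1 + g) * ((1 + (1 + g) * ((1 + t) / (1 + s) - 1)) * (1 + (1 + γ) * s)) := by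
        gcongr
    _ = ((1 + (1 + g) * ((1 + t) / (1 + s) - 1)) * (1 + s) ^ (1 + g)) * (1 + (1 + γ) * s) := by
        ring
    _ ≤ _ := by gcongr

lemma lsv_cone_left {γ g z w : ℝ} (hγ : 0 < γ) (hg : γ ≤ g) (hz : 0 < z) (hzw : z ≤ w)
    (hw : w ≤ 1 / 2) :
    lsv γ z ^ (1 + g) * dlsv γ w * w ^ (1 + g) ≤ lsv γ w ^ (1 + g) * dlsv γ z * z ^ (1 + g) := by
  have hw0 : 0 < w := hz.trans_le hzw
  rw [lsv_left hz.le (hzw.trans hw), lsv_left hw0.le hw, dlsv_left hz.le (hzw.trans hw),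
    dlsv_left hw0.le hw, Real.mul_rpow hz.le (by positivity), Real.mul_rpow hw0.le (by positivity)]
  have h := cone_aux hγ hg (s := (2 * z) ^ γ) (t := (2 * w) ^ γ) (by positivity) (by gcongr)
  have hp : 0 ≤ z ^ (1 + g) * w ^ (1 + g) := by positivity
  nlinarith [mul_le_mul_of_nonneg_left h hp]

lemma lsv_cone_right {γ g z w : ℝ} (hg : 0 < g) (hz : 1 / 2 < z) (hzw : z ≤ w) :
    lsv γ z ^ (1 + g) * dlsv γ w * w ^ (1 + g) ≤ lsv γ w ^ (1 + g) * dlsv γ z * z ^ (1 + g) := by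
  rw [lsv_right hz, lsv_right (hz.trans_le hzw), dlsv_right hz, dlsv_right (hz.trans_le hzw)]
  have h : (2 * z - 1) ^ (1 + g) * w ^ (1 + g) ≤ (2 * w - 1) ^ (1 + g) * z ^ (1 + g) := by
    rw [← Real.mul_rpow (by linarith) (by linarith), ← Real.mul_rpow (by linarith) (by linarith)]
    apply Real.rpow_le_rpow
    · apply mul_nonneg <;> linarith
    · nlinarith
    · linarith
  linarith

lemma dlsv_ge {γ δ x : ℝ} (hγ : γ ∈ Ioo (0:ℝ) 1) (hδ : 0 < δ) (hδ1 : δ ≤ 1) (hx : δ ≤ x) :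
    1 + δ ≤ dlsv γ x := by
  have hγ0 := hγ.1
  by_cases h : x ≤ 1 / 2
  · rw [dlsv_left (hδ.le.trans hx) h]
    have h1 : δ ≤ (2 * x) ^ γ := by
      calc δ = δ ^ (1:ℝ) := (Real.rpow_one δ).symm
        _ ≤ δ ^ γ := Real.rpow_le_rpow_of_exponent_ge hδ hδ1 hγ.2.le
        _ ≤ (2 * x) ^ γ := by gcongr; linarith
    nlinarith
  · rw [dlsv_right (not_le.1 h)]; linarith

section dyn
variable {m : ℕ}

/-- derivative of the random composition -/
def dComp (γ : Fin m → ℝ) (ω : Om m) : ℕ → ℝ → ℝ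
  | 0 => fun _ => 1
  | n + 1 => fun x => dlsv (γ (ω (n : ℤ))) (randComp (fun i => lsv (γ i)) ω n x) * dComp γ ω n x

lemma randComp_mem {γ : Fin m → ℝ} (hγ : ∀ i, γ i ∈ Ioo (0:ℝ) 1) (ω : Om m) (k : ℕ) {x : ℝ}
    (hx : x ∈ Ioc (0:ℝ) 1) : randComp (fun i => lsv (γ i)) ω k x ∈ Ioc (0:ℝ) 1 := by
  induction k with
  | zero => exact hx
  | succ n ih => exact lsv_mem (hγ _).1 ih

lemma randComp_mem_Icc {γ : Fin m → ℝ} (hγ : ∀ i, γ i ∈ Ioo (0:ℝ) 1) (ω : Om m) (k : ℕ) {x : ℝ}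
    (hx : x ∈ Icc (0:ℝ) 1) : randComp (fun i => lsv (γ i)) ω k x ∈ Icc (0:ℝ) 1 := by
  induction k with
  | zero => exact hx
  | succ n ih => exact lsv_mem_Icc (hγ _).1 ih

lemma dComp_ge_one {γ : Fin m → ℝ} (hγ : ∀ i, γ i ∈ Ioo (0:ℝ) 1) (ω : Om m) (k : ℕ) {x : ℝ}
    (hx : x ∈ Ioc (0:ℝ) 1) : 1 ≤ dComp γ ω k x := by
  induction k with
  | zero => exact le_rfl
  | succ n ih =>
    exact one_le_mul_of_one_le_of_one_le
      (dlsv_ge_one (hγ _).1 (randComp_mem hγ ω n hx).1.le) ih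

lemma dComp_ge {γ : Fin m → ℝ} (hγ : ∀ i, γ i ∈ Ioo (0:ℝ) 1) (ω : Om m) (k : ℕ) {x δ : ℝ}
    (hδ : 0 < δ) (hδx : δ ≤ x) (hx : x ≤ 1) : 1 + δ ≤ dComp γ ω (k + 1) x := by
  induction k with
  | zero => simpa [dComp, randComp] using dlsv_ge (hγ _) hδ (hδx.trans hx) hδx
  | succ n ih =>
    have h1 := dlsv_ge_one (hγ (ω ((n+1 : ℕ) : ℤ))).1
      (randComp_mem hγ ω (n+1) (x := x) ⟨hδ.trans_le hδx, hx⟩).1.le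
    change 1 + δ ≤ dlsv _ _ * dComp γ ω (n+1) x
    nlinarith

/-- `(a,b]` is a branch of `T_ω^k` -/
structure IsBr (γ : Fin m → ℝ) (g : ℝ) (ω : Om m) (k : ℕ) (a b : ℝ) : Prop where
  ha : 0 ≤ a
  hab : a < b
  hb : b ≤ 1
  top : randComp (fun i => lsv (γ i)) ω k b = 1
  surj : ∀ y ∈ Ioc (0:ℝ) 1, ∃ x ∈ Ioc a b, randComp (fun i => lsv (γ i)) ω k x = y
  mv : ∀ x y, x ∈ Ioc a b → y ∈ Ioc a b → x ≤ y →
    dComp γ ω k x * (y - x) ≤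
      randComp (fun i => lsv (γ i)) ω k y - randComp (fun i => lsv (γ i)) ω k x ∧
    randComp (fun i => lsv (γ i)) ω k y - randComp (fun i => lsv (γ i)) ω k x ≤
      dComp γ ω k y * (y - x)
  mono : ∀ x y, x ∈ Ioc a b → y ∈ Ioc a b → x ≤ y → dComp γ ω k x ≤ dComp γ ω k y
  cone : ∀ x y, x ∈ Ioc a b → y ∈ Ioc a b → x ≤ y →
    randComp (fun i => lsv (γ i)) ω k x ^ (1 + g) * dComp γ ω k y ≤
    randComp (fun i => lsv (γ i)) ω k y ^ (1 + g) * dComp γ ω k x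

lemma IsBr.Fmono {γ : Fin m → ℝ} (hγ : ∀ i, γ i ∈ Ioo (0:ℝ) 1) {g : ℝ} {ω : Om m} {k : ℕ}
    {a b : ℝ} (H : IsBr γ g ω k a b) {x y : ℝ} (hx : x ∈ Ioc a b) (hy : y ∈ Ioc a b)
    (hxy : x ≤ y) :
    y - x ≤ randComp (fun i => lsv (γ i)) ω k y - randComp (fun i => lsv (γ i)) ω k x := by
  have h := (H.mv x y hx hy hxy).1
  have h1 := dComp_ge_one hγ ω k (x := x) ⟨H.ha.trans_lt hx.1, hx.2.trans H.hb⟩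
  nlinarith

/-- one step refinement on a piece on which the next map is one of its two branches -/
lemma IsBr.step {γ : Fin m → ℝ} (hγ : ∀ i, γ i ∈ Ioo (0:ℝ) 1) {g : ℝ} (hg : ∀ i, γ i ≤ g)
    {ω : Om m} {k : ℕ} {a b a' b' : ℝ} (H : IsBr γ g ω k a b) (ha' : a ≤ a') (hb' : b' ≤ b)
    (hab : a' < b')
    (top : randComp (fun i => lsv (γ i)) ω (k+1) b' = 1)
    (surj : ∀ y ∈ Ioc (0:ℝ) 1, ∃ x ∈ Ioc a' b', randComp (fun i => lsv (γ i)) ω (k+1) x = y)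
    (hbr : (∀ x ∈ Ioc a' b', randComp (fun i => lsv (γ i)) ω k x ≤ 1 / 2) ∨
      (∀ x ∈ Ioc a' b', 1 / 2 < randComp (fun i => lsv (γ i)) ω k x)) :
    IsBr γ g ω (k+1) a' b' := by
  have hsub : Ioc a' b' ⊆ Ioc a b := Ioc_subset_Ioc ha' hb'
  have hsub1 : Ioc a' b' ⊆ Ioc 0 1 := hsub.trans (Ioc_subset_Ioc H.ha H.hb)
  set F := randComp (fun i => lsv (γ i)) ω k with hF
  set G := γ (ω (k:ℤ)) with hG
  have hG0 : 0 < G := (hγ _).1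
  have hGg : G ≤ g := hg _
  have hFs : ∀ x, randComp (fun i => lsv (γ i)) ω (k+1) x = lsv G (F x) := fun x => rfl
  have hDs : ∀ x, dComp γ ω (k+1) x = dlsv G (F x) * dComp γ ω k x := fun x => rfl
  have single : ∀ x y, x ∈ Ioc a' b' → y ∈ Ioc a' b' → x ≤ y →
      (dlsv G (F x) * (F y - F x) ≤ lsv G (F y) - lsv G (F x) ∧
        lsv G (F y) - lsv G (F x) ≤ dlsv G (F y) * (F y - F x)) ∧
      dlsv G (F x) ≤ dlsv G (F y) ∧
      lsv G (F x) ^ (1 + g) * dlsv G (F y) * (F y) ^ (1 + g) ≤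
        lsv G (F y) ^ (1 + g) * dlsv G (F x) * (F x) ^ (1 + g) := by
    intro x y hx hy hxy
    have hFx := (randComp_mem hγ ω k (hsub1 hx)).1
    have hFxy : F x ≤ F y := by
      have := H.Fmono hγ (hsub hx) (hsub hy) hxy
      linarith
    rcases hbr with h | h
    · exact ⟨lsv_mv_left hG0 hFx hFxy (h y hy), dlsv_mono_left hG0 hFx hFxy (h y hy),
        lsv_cone_left hG0 hGg hFx hFxy (h y hy)⟩
    · refine ⟨lsv_mv_right (h x hx) hFxy, ?_, lsv_cone_right (hG0.trans_le hGg) (h x hx) hFxy⟩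
      rw [dlsv_right (h x hx), dlsv_right (h y hy)]
  refine ⟨H.ha.trans ha', hab, hb'.trans H.hb, top, surj, ?_, ?_, ?_⟩
  · intro x y hx hy hxy
    obtain ⟨⟨h1, h2⟩, -, -⟩ := single x y hx hy hxy
    obtain ⟨h3, h4⟩ := H.mv x y (hsub hx) (hsub hy) hxy
    have hdx := dlsv_ge_one hG0 (randComp_mem hγ ω k (hsub1 hx)).1.le
    have hdy := dlsv_ge_one hG0 (randComp_mem hγ ω k (hsub1 hy)).1.le
    simp only [hFs, hDs]
    constructor
    · refine le_trans ?_ h1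
      rw [mul_assoc]
      exact mul_le_mul_of_nonneg_left h3 (by linarith)
    · refine le_trans h2 ?_
      rw [mul_assoc]
      exact mul_le_mul_of_nonneg_left h4 (by linarith)
  · intro x y hx hy hxy
    obtain ⟨-, h1, -⟩ := single x y hx hy hxy
    have h2 := H.mono x y (hsub hx) (hsub hy) hxy
    have hdx := dlsv_ge_one hG0 (randComp_mem hγ ω k (hsub1 hx)).1.le
    have hDx := dComp_ge_one hγ ω k (hsub1 hx)
    simp only [hDs]
    exact mul_le_mul h1 h2 (by linarith) (by linarith)
  · intro x y hx hy hxy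
    obtain ⟨-, -, h1⟩ := single x y hx hy hxy
    have h2 := H.cone x y (hsub hx) (hsub hy) hxy
    have hFx := (randComp_mem hγ ω k (hsub1 hx)).1
    have hFy := (randComp_mem hγ ω k (hsub1 hy)).1
    have hDx := dComp_ge_one hγ ω k (hsub1 hx)
    have hDy := dComp_ge_one hγ ω k (hsub1 hy)
    have hdx := dlsv_ge_one hG0 hFx.le
    have hdy := dlsv_ge_one hG0 hFy.le
    have hlx := (lsv_mem hG0 (randComp_mem hγ ω k (hsub1 hx))).1
    have hly := (lsv_mem hG0 (randComp_mem hγ ω k (hsub1 hy))).1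
    simp only [hFs, hDs]
    have hpx : 0 < F x ^ (1 + g) := Real.rpow_pos_of_pos hFx _
    have hpy : 0 < F y ^ (1 + g) := Real.rpow_pos_of_pos hFy _
    have hqx : 0 < lsv G (F x) ^ (1 + g) := Real.rpow_pos_of_pos hlx _
    have hqy : 0 < lsv G (F y) ^ (1 + g) := Real.rpow_pos_of_pos hly _
    have h3 := mul_le_mul h1 h2 (by positivity) (by positivity)
    have h4 : 0 < F x ^ (1 + g) * F y ^ (1 + g) := by positivity
    refine le_of_mul_le_mul_right ?_ h4
    calc _ = lsv G (F x) ^ (1 + g) * dlsv G (F y) * F y ^ (1 + g) *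
          (F x ^ (1 + g) * dComp γ ω k y) := by ring
      _ ≤ _ := h3
      _ = _ := by ring

lemma lsv_left_surj {γ : ℝ} (hγ : 0 < γ) {y : ℝ} (hy : y ∈ Ioc (0:ℝ) 1) :
    ∃ x ∈ Ioc (0:ℝ) (1/2), lsv γ x = y := by
  have hc : ContinuousOn (fun x : ℝ => x * (1 + (2 * x) ^ γ)) (Icc 0 (1/2)) := by
    apply Continuous.continuousOn
    have : Continuous fun x : ℝ => (2 * x) ^ γ :=
      (continuous_const.mul continuous_id).rpow_const (fun _ => Or.inr hγ.le)
    fun_prop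
  have h := intermediate_value_Icc (by norm_num : (0:ℝ) ≤ 1/2) hc
  have : y ∈ Icc ((fun x : ℝ => x * (1 + (2 * x) ^ γ)) 0)
      ((fun x : ℝ => x * (1 + (2 * x) ^ γ)) (1/2)) := by
    norm_num
    exact ⟨hy.1.le, hy.2⟩
  obtain ⟨x, hx, hxy⟩ := h this
  simp only at hxy
  have hx0 : x ≠ 0 := by
    rintro rfl
    simp at hxy
    linarith [hy.1]
  refine ⟨x, ⟨lt_of_le_of_ne hx.1 hx0.symm, hx.2⟩, ?_⟩
  rw [lsv_left hx.1 hx.2, hxy]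

lemma IsBr.split {γ : Fin m → ℝ} (hγ : ∀ i, γ i ∈ Ioo (0:ℝ) 1) {g : ℝ} (hg : ∀ i, γ i ≤ g)
    {ω : Om m} {k : ℕ} {a b : ℝ} (H : IsBr γ g ω k a b) :
    ∃ c, a < c ∧ c < b ∧ IsBr γ g ω (k+1) a c ∧ IsBr γ g ω (k+1) c b := by
  obtain ⟨c, hc, hFc⟩ := H.surj (1/2) (by norm_num)
  have hG0 : 0 < γ (ω (k:ℤ)) := (hγ _).1
  have hbb : b ∈ Ioc a b := ⟨H.hab, le_rfl⟩
  have hcb : c < b := by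
    refine lt_of_le_of_ne hc.2 ?_
    rintro rfl
    rw [H.top] at hFc
    norm_num at hFc
  have hle : ∀ x ∈ Ioc a c, randComp (fun i => lsv (γ i)) ω k x ≤ 1 / 2 := by
    intro x hx
    have := H.Fmono hγ ⟨hx.1, hx.2.trans hc.2⟩ hc hx.2
    linarith [hx.2]
  have hlt : ∀ x ∈ Ioc c b, 1 / 2 < randComp (fun i => lsv (γ i)) ω k x := by
    intro x hx
    have := H.Fmono hγ hc ⟨hc.1.trans hx.1, hx.2⟩ hx.1.le
    linarith [hx.1]
  refine ⟨c, hc.1, hcb, ?_, ?_⟩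
  · refine H.step hγ hg le_rfl hcb.le hc.1 ?_ ?_ (Or.inl hle)
    · change lsv (γ (ω (k:ℤ))) (randComp (fun i => lsv (γ i)) ω k c) = 1
      rw [hFc, lsv_left (by norm_num) le_rfl]; norm_num
    · intro y hy
      obtain ⟨z, hz, hzy⟩ := lsv_left_surj hG0 hy
      obtain ⟨x, hx, hxz⟩ := H.surj z ⟨hz.1, by linarith [hz.2]⟩
      refine ⟨x, ⟨hx.1, ?_⟩, ?_⟩
      · by_contra hcx
        have := hlt x ⟨not_le.1 hcx, hx.2⟩
        linarith [hz.2]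
      · change lsv (γ (ω (k:ℤ))) (randComp (fun i => lsv (γ i)) ω k x) = y
        rw [hxz, hzy]
  · refine H.step hγ hg hc.1.le le_rfl hcb ?_ ?_ (Or.inr hlt)
    · change lsv (γ (ω (k:ℤ))) (randComp (fun i => lsv (γ i)) ω k b) = 1
      rw [H.top, lsv_right (by norm_num)]; norm_num
    · intro y hy
      obtain ⟨x, hx, hxz⟩ := H.surj ((y+1)/2) ⟨by linarith [hy.1], by linarith [hy.2]⟩
      refine ⟨x, ⟨?_, hx.2⟩, ?_⟩
      · by_contra hcx
        have := hle x ⟨hx.1, not_lt.1 hcx⟩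
        linarith [hy.1]
      · change lsv (γ (ω (k:ℤ))) (randComp (fun i => lsv (γ i)) ω k x) = y
        rw [hxz, lsv_right (by linarith [hy.1])]; ring

lemma exists_branches {γ : Fin m → ℝ} (hγ : ∀ i, γ i ∈ Ioo (0:ℝ) 1) {g : ℝ} (hg : ∀ i, γ i ≤ g)
    (hg0 : 0 < g) (ω : Om m) (k : ℕ) :
    ∃ (ι : Type) (_ : Fintype ι) (a b : ι → ℝ), (∀ i, IsBr γ g ω k (a i) (b i)) ∧
      Ioc (0:ℝ) 1 ⊆ ⋃ i, Ioc (a i) (b i) ∧ ∑ i, (b i - a i) = 1 := by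
  induction k with
  | zero =>
    refine ⟨Unit, inferInstance, fun _ => 0, fun _ => 1, fun _ => ?_, subset_iUnion (fun _ : Unit => Ioc (0:ℝ) 1) (), by simp⟩
    refine ⟨le_rfl, one_pos, le_rfl, rfl, fun y hy => ⟨y, hy, rfl⟩, ?_, ?_, ?_⟩
    · intro x y _ _ _; simp [dComp, randComp]
    · intro x y _ _ _; simp [dComp]
    · intro x y hx _ hxy
      simp only [dComp, randComp, mul_one]
      exact Real.rpow_le_rpow hx.1.le hxy (by linarith)
  | succ n ih =>
    obtain ⟨ι, hι, a, b, hB, hcov, hsum⟩ := ih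
    choose c hac hcb hl hr using fun i => (hB i).split hγ hg
    refine ⟨ι × Bool, inferInstance, fun p => if p.2 then c p.1 else a p.1,
      fun p => if p.2 then b p.1 else c p.1, ?_, ?_, ?_⟩
    · rintro ⟨i, _ | _⟩
      · simpa using hl i
      · simpa using hr i
    · intro x hx
      obtain ⟨i, hi⟩ := mem_iUnion.1 (hcov hx)
      by_cases h : x ≤ c i
      · exact mem_iUnion.2 ⟨(i, false), by simpa using ⟨hi.1, h⟩⟩
      · exact mem_iUnion.2 ⟨(i, true), by simpa using ⟨not_le.1 h, hi.2⟩⟩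
    · rw [Fintype.sum_prod_type, ← hsum]
      refine Finset.sum_congr rfl fun i _ => ?_
      simp
      ring

lemma IsBr.len {γ : Fin m → ℝ} (hγ : ∀ i, γ i ∈ Ioo (0:ℝ) 1) {g : ℝ} {ω : Om m} {k : ℕ}
    {a b : ℝ} (H : IsBr γ g ω k a b) : 1 ≤ dComp γ ω k b * (b - a) := by
  have hbb : b ∈ Ioc a b := ⟨H.hab, le_rfl⟩
  have hD := dComp_ge_one hγ ω k (x := b) ⟨H.ha.trans_lt H.hab, H.hb⟩
  refine le_of_forall_pos_le_add fun e he => ?_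
  obtain ⟨x, hx, hxe⟩ := H.surj (min e 1) ⟨lt_min he one_pos, min_le_right _ _⟩
  have h1 := (H.mv x b hx hbb hx.2).2
  rw [H.top, hxe] at h1
  have h2 : dComp γ ω k b * (b - x) ≤ dComp γ ω k b * (b - a) := by
    apply mul_le_mul_of_nonneg_left <;> linarith [hx.1]
  have := min_le_left e 1
  linarith

/-- the constant of the return-time estimate -/
def Kret (g δ : ℝ) : ℝ := 4 / (δ * (δ / 2) ^ (1 + g)) + 2 / δ

lemma Kret_pos {g δ : ℝ} (hδ : 0 < δ) : 0 < Kret g δ := by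
  unfold Kret; positivity

/-- measure of the set of points returning close to themselves -/
lemma return_measure {γ : Fin m → ℝ} (hγ : ∀ i, γ i ∈ Ioo (0:ℝ) 1) {g : ℝ} (hg : ∀ i, γ i ≤ g)
    (hg0 : 0 < g) (ω : Om m) (k : ℕ) {δ ε : ℝ} (hδ : 0 < δ) (hδ1 : δ ≤ 1) (hε : 0 ≤ ε) :
    volume {x | x ∈ Icc δ 1 ∧ |randComp (fun i => lsv (γ i)) ω (k+1) x - x| ≤ ε} ≤
      ENNReal.ofReal (Kret g δ * ε) := by
  set E := {x | x ∈ Icc δ 1 ∧ |randComp (fun i => lsv (γ i)) ω (k+1) x - x| ≤ ε} with hE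
  rcases lt_or_ge (δ / 2) ε with hbig | hsmall
  · calc volume E ≤ volume (Icc δ 1) := measure_mono fun x hx => hx.1
      _ = ENNReal.ofReal (1 - δ) := by rw [Real.volume_Icc]
      _ ≤ _ := by
        apply ENNReal.ofReal_le_ofReal
        have h1 : 1 ≤ 2 / δ * ε := by
          rw [div_mul_eq_mul_div, le_div_iff₀ hδ]; linarith
        have h2 : 0 ≤ 4 / (δ * (δ / 2) ^ (1 + g)) * ε := by positivity
        unfold Kret; rw [add_mul]; linarith
  obtain ⟨ι, hι, a, b, hB, hcov, hsum⟩ := exists_branches hγ hg hg0 ω (k+1)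
  set K1 := 4 / (δ * (δ / 2) ^ (1 + g)) with hK1
  have hpow : 0 < (δ / 2) ^ (1 + g) := by positivity
  have piece : ∀ i, volume (E ∩ Ioc (a i) (b i)) ≤ ENNReal.ofReal (K1 * ε * (b i - a i)) := by
    intro i
    have H := hB i
    refine (Real.volume_le_diam _).trans ?_
    refine Metric.ediam_le ?_
    have main : ∀ x ∈ E ∩ Ioc (a i) (b i), ∀ y ∈ E ∩ Ioc (a i) (b i), x ≤ y →
        y - x ≤ K1 * ε * (b i - a i) := by
      rintro x ⟨⟨hx1, hx2⟩, hx3⟩ y ⟨⟨hy1, hy2⟩, hy3⟩ hxy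
      have h1 := (H.mv x y hx3 hy3 hxy).1
      have hD := dComp_ge hγ ω k hδ hx1.1 hx1.2
      have h2 := H.cone x (b i) hx3 ⟨H.hab, le_rfl⟩ hx3.2
      rw [H.top, Real.one_rpow, one_mul] at h2
      have h3 := H.len hγ
      rw [abs_le] at hx2 hy2
      set F := randComp (fun i => lsv (γ i)) ω (k+1)
      set D := dComp γ ω (k+1)
      have hFx : δ / 2 ≤ F x := by linarith [hx1.1, hx2.1]
      have h4 : (δ / 2) ^ (1 + g) ≤ F x ^ (1 + g) := by gcongr
      have hDb : 1 ≤ D (b i) := dComp_ge_one hγ ω (k+1) ⟨H.ha.trans_lt H.hab, H.hb⟩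
      have h5 : (δ / 2) ^ (1 + g) * D (b i) ≤ D x :=
        (mul_le_mul_of_nonneg_right h4 (by linarith)).trans h2
      have h6 : D x * (δ / 2) ≤ D x - 1 := by nlinarith
      have h7 : (D x - 1) * (y - x) ≤ 2 * ε := by nlinarith
      have hyx : 0 ≤ y - x := by linarith
      have h8 : (δ / 2) ^ (1 + g) * D (b i) * (δ / 2) * (y - x) ≤ 2 * ε := by
        refine le_trans ?_ h7
        refine mul_le_mul_of_nonneg_right (le_trans ?_ h6) hyx
        exact mul_le_mul_of_nonneg_right h5 (by linarith)
      have hba : 0 < b i - a i := by linarith [H.hab]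
      have h9 : (δ / 2) ^ (1 + g) * (δ / 2) * (y - x) ≤ 2 * ε * (b i - a i) := by
        have h10 := mul_le_mul_of_nonneg_right h8 hba.le
        have h11 : 0 ≤ (δ / 2) ^ (1 + g) * (δ / 2) * (y - x) := by positivity
        nlinarith [mul_le_mul_of_nonneg_left h3 h11]
      have : K1 * ε * (b i - a i) = (4 * ε * (b i - a i)) / (δ * (δ / 2) ^ (1 + g)) := by
        rw [hK1]; ring
      rw [this, le_div_iff₀ (by positivity)]
      nlinarith
    intro x hx y hy
    rw [edist_dist]
    apply ENNReal.ofReal_le_ofReal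
    rw [Real.dist_eq]
    rcases le_total x y with hxy | hxy
    · rw [abs_sub_comm, abs_of_nonneg (by linarith)]; exact main x hx y hy hxy
    · rw [abs_of_nonneg (by linarith)]; exact main y hy x hx hxy
  have hcovE : E ⊆ ⋃ i, E ∩ Ioc (a i) (b i) := by
    intro x hx
    obtain ⟨i, hi⟩ := mem_iUnion.1 (hcov ⟨hδ.trans_le hx.1.1, hx.1.2⟩)
    exact mem_iUnion.2 ⟨i, hx, hi⟩
  have hK1p : 0 ≤ K1 * ε := by positivity
  calc volume E ≤ volume (⋃ i, E ∩ Ioc (a i) (b i)) := measure_mono hcovE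
    _ ≤ ∑ i, volume (E ∩ Ioc (a i) (b i)) := measure_iUnion_fintype_le _ _
    _ ≤ ∑ i, ENNReal.ofReal (K1 * ε * (b i - a i)) := Finset.sum_le_sum fun i _ => piece i
    _ = ENNReal.ofReal (∑ i, K1 * ε * (b i - a i)) :=
      (ENNReal.ofReal_sum_of_nonneg fun i _ =>
        mul_nonneg hK1p (by linarith [(hB i).hab])).symm
    _ = ENNReal.ofReal (K1 * ε) := by rw [← Finset.mul_sum, hsum, mul_one]
    _ ≤ _ := by
      apply ENNReal.ofReal_le_ofReal
      unfold Kret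
      rw [add_mul]
      have : 0 ≤ 2 / δ * ε := by positivity
      linarith

end dyn


section dyn2
variable {m : ℕ}

lemma shift_iterate (ω : Om m) (j : ℕ) (i : ℤ) : (shift^[j] ω) i = ω (i + j) := by
  induction j generalizing ω with
  | zero => simp
  | succ n ih =>
    rw [Function.iterate_succ_apply, ih]
    simp only [shift]
    congr 1; push_cast; ring

lemma shiftInv_iterate (ω : Om m) (j : ℕ) (i : ℤ) : (shiftInv^[j] ω) i = ω (i - j) := by
  induction j generalizing ω with
  | zero => simp
  | succ n ih =>
    rw [Function.iterate_succ_apply, ih]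
    simp only [shiftInv]
    congr 1; push_cast; ring

lemma measurable_shift_iterate (j : ℕ) : Measurable (shift^[j] : Om m → Om m) := by
  rw [measurable_pi_iff]
  intro i
  simp only [shift_iterate]
  exact measurable_pi_apply _

lemma measurable_shiftInv_iterate (j : ℕ) : Measurable (shiftInv^[j] : Om m → Om m) := by
  rw [measurable_pi_iff]
  intro i
  simp only [shiftInv_iterate]
  exact measurable_pi_apply _

lemma randComp_add (T : Fin m → ℝ → ℝ) (ω : Om m) (j k : ℕ) (x : ℝ) :
    randComp T ω (j + k) x = randComp T (shift^[j] ω) k (randComp T ω j x) := by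
  induction k with
  | zero => rfl
  | succ n ih =>
    change T (ω ((j + n : ℕ) : ℤ)) (randComp T ω (j + n) x) =
      T ((shift^[j] ω) (n : ℤ)) (randComp T (shift^[j] ω) n (randComp T ω j x))
    rw [ih, shift_iterate]
    congr 2; push_cast; ring

lemma randComp_congr (T : Fin m → ℝ → ℝ) {ω ω' : Om m} (k : ℕ)
    (h : ∀ i : ℕ, i < k → ω i = ω' i) (x : ℝ) :
    randComp T ω k x = randComp T ω' k x := by
  induction k with
  | zero => rfl
  | succ n ih =>
    change T (ω (n : ℤ)) (randComp T ω n x) = T (ω' (n : ℤ)) (randComp T ω' n x)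
    rw [ih (fun i hi => h i (by omega)), h n (by omega)]

lemma measurable_randComp_joint (γ : Fin m → ℝ) (k : ℕ) :
    Measurable (fun p : Om m × ℝ => randComp (fun i => lsv (γ i)) p.1 k p.2) := by
  induction k with
  | zero => exact measurable_snd
  | succ n ih =>
    have h1 : Measurable (fun q : Fin m × ℝ => lsv (γ q.1) q.2) :=
      measurable_from_prod_countable_right (fun i => measurable_lsv (γ i))
    exact h1.comp (((measurable_pi_apply (n:ℤ)).comp measurable_fst).prodMk ih)

lemma measurable_randComp (γ : Fin m → ℝ) (ω : Om m) (k : ℕ) :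
    Measurable (randComp (fun i => lsv (γ i)) ω k) :=
  (measurable_randComp_joint γ k).comp (measurable_const.prodMk measurable_id)

instance : IsProbabilityMeasure mLeb := ⟨by simp [mLeb]⟩

/-- The set of points of the `ρ`-ball around `x0` which return there at time `k`. -/
def retSet (γ : Fin m → ℝ) (ω : Om m) (k : ℕ) (ρ x0 : ℝ) : Set ℝ :=
  {x | |x - x0| < ρ ∧ |randComp (fun i => lsv (γ i)) ω k x - x0| < ρ}

lemma measurableSet_ret_joint (γ : Fin m → ℝ) (i k : ℕ) (ρ : ℝ) :
    MeasurableSet {p : (ℝ × Om m) × ℝ | p.2 ∈ retSet γ (shift^[i] p.1.2) k ρ p.1.1} := by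
  have h1 : Measurable (fun p : (ℝ × Om m) × ℝ =>
      randComp (fun i => lsv (γ i)) (shift^[i] p.1.2) k p.2) :=
    (measurable_randComp_joint γ k).comp
      (((measurable_shift_iterate i).comp (measurable_snd.comp measurable_fst)).prodMk
        measurable_snd)
  have hx0 : Measurable (fun p : (ℝ × Om m) × ℝ => p.1.1) := measurable_fst.comp measurable_fst
  have h2 : Measurable (fun p : (ℝ × Om m) × ℝ => |p.2 - p.1.1|) :=
    (measurable_snd.sub hx0).abs
  have h3 : Measurable (fun p : (ℝ × Om m) × ℝ =>
      |randComp (fun i => lsv (γ i)) (shift^[i] p.1.2) k p.2 - p.1.1|) := (h1.sub hx0).abs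
  exact (measurableSet_lt h2 measurable_const).inter (measurableSet_lt h3 measurable_const)

lemma measurable_ret (γ : Fin m → ℝ) (i k : ℕ) (ρ : ℝ) :
    Measurable (fun p : ℝ × Om m => mLeb (retSet γ (shift^[i] p.2) k ρ p.1)) :=
  measurable_measure_prodMk_left (measurableSet_ret_joint γ i k ρ)

lemma lintegral_ret {γ : Fin m → ℝ} (hγ : ∀ i, γ i ∈ Ioo (0:ℝ) 1) {g : ℝ} (hg : ∀ i, γ i ≤ g)
    (hg0 : 0 < g) (ω : Om m) (k : ℕ) {δ ρ : ℝ} (hδ : 0 < δ) (hδ1 : δ ≤ 1) (hρ : 0 ≤ ρ)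
    (hρδ : ρ ≤ δ) :
    ∫⁻ x0 in Icc (2 * δ) 1, mLeb (retSet γ ω (k+1) ρ x0) ≤
      ENNReal.ofReal (Kret g δ * (2 * ρ) * (2 * ρ)) := by
  set S : Set (ℝ × ℝ) := {p | p.2 ∈ retSet γ ω (k+1) ρ p.1} with hS
  have hSm : MeasurableSet S := by
    have h := measurableSet_ret_joint γ 0 (k+1) ρ
    have hf : Measurable (fun p : ℝ × ℝ => ((p.1, ω), p.2)) :=
      (measurable_fst.prodMk measurable_const).prodMk measurable_snd
    exact hf h
  set E := {x | x ∈ Icc δ 1 ∧ |randComp (fun i => lsv (γ i)) ω (k+1) x - x| ≤ 2 * ρ} with hE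
  have hEm : MeasurableSet E := by
    refine measurableSet_Icc.inter ?_
    exact measurableSet_le ((measurable_randComp γ ω (k+1)).sub measurable_id).abs measurable_const
  calc ∫⁻ x0 in Icc (2 * δ) 1, mLeb (retSet γ ω (k+1) ρ x0)
      = ((volume.restrict (Icc (2 * δ) 1)).prod mLeb) S := by
        rw [Measure.prod_apply hSm]; rfl
    _ = ∫⁻ x, (volume.restrict (Icc (2 * δ) 1)) ((fun x0 => (x0, x)) ⁻¹' S) ∂mLeb := by
        rw [Measure.prod_apply_symm hSm]
    _ ≤ ∫⁻ x, E.indicator (fun _ => ENNReal.ofReal (2 * ρ)) x ∂mLeb := by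
        unfold mLeb
        refine setLIntegral_mono_ae' measurableSet_Icc (Eventually.of_forall fun x hx => ?_)
        by_cases hxE : x ∈ E
        · rw [indicator_of_mem hxE]
          calc _ ≤ volume ((fun x0 => (x0, x)) ⁻¹' S) := Measure.restrict_apply_le _ _
            _ ≤ volume (Ioo (x - ρ) (x + ρ)) := by
              refine measure_mono fun x0 hx0 => ?_
              have := abs_lt.1 (show |x - x0| < ρ from hx0.1)
              constructor <;> linarith [this.1, this.2]
            _ = ENNReal.ofReal (2 * ρ) := by rw [Real.volume_Ioo]; congr 1; ring
        · rw [indicator_of_notMem hxE, nonpos_iff_eq_zero, Measure.restrict_apply']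
          · convert measure_empty (μ := (volume : Measure ℝ))
            ext x0
            simp only [mem_inter_iff, mem_preimage, mem_empty_iff_false, iff_false]
            rintro ⟨h1, h2⟩
            have h3 := abs_lt.1 (show |x - x0| < ρ from h1.1)
            have h4 := abs_lt.1 (show |randComp (fun i => lsv (γ i)) ω (k+1) x - x0| < ρ from h1.2)
            apply hxE
            refine ⟨⟨by linarith [h2.1], hx.2⟩, ?_⟩
            rw [abs_le]
            constructor <;> linarith [h3.1, h3.2, h4.1, h4.2]
          · exact measurableSet_Icc
    _ = ENNReal.ofReal (2 * ρ) * mLeb E := by rw [lintegral_indicator_const hEm]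
    _ ≤ ENNReal.ofReal (2 * ρ) * ENNReal.ofReal (Kret g δ * (2 * ρ)) := by
        gcongr
        exact (Measure.restrict_apply_le _ _).trans
          (return_measure hγ hg hg0 ω k hδ hδ1 (by linarith))
    _ = _ := by
        rw [← ENNReal.ofReal_mul (by linarith)]
        congr 1; ring

/-- The short-return sum. -/
def Xsum (γ : Fin m → ℝ) (θ : ℝ) (r K n : ℕ) (x0 : ℝ) (ω : Om m) : ℝ≥0∞ :=
  ∑ i ∈ Finset.range (K * n + 1), ∑ k ∈ Finset.range ⌈(n:ℝ) ^ θ⌉₊,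
    mLeb (retSet γ (shift^[i] ω) (k+1) (r / n) x0)

/-- The dyadic short-return sum. -/
def Zsum (γ : Fin m → ℝ) (θ : ℝ) (r K l : ℕ) (x0 : ℝ) (ω : Om m) : ℝ≥0∞ :=
  ∑ i ∈ Finset.range (K * 2 ^ (l + 1) + 1), ∑ k ∈ Finset.range ⌈((2:ℝ) ^ (l + 1)) ^ θ⌉₊,
    mLeb (retSet γ (shift^[i] ω) (k+1) (r / 2 ^ l) x0)

lemma retSet_mono (γ : Fin m → ℝ) (ω : Om m) (k : ℕ) {ρ ρ' : ℝ} (h : ρ ≤ ρ') (x0 : ℝ) :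
    retSet γ ω k ρ x0 ⊆ retSet γ ω k ρ' x0 :=
  fun _ hx => ⟨hx.1.trans_le h, hx.2.trans_le h⟩

lemma Xsum_le_Zsum (γ : Fin m → ℝ) {θ : ℝ} (hθ : 0 < θ) (r K : ℕ) {n : ℕ} (hn : n ≠ 0) (x0 : ℝ)
    (ω : Om m) : Xsum γ θ r K n x0 ω ≤ Zsum γ θ r K (Nat.log 2 n) x0 ω := by
  have h1 : 2 ^ Nat.log 2 n ≤ n := Nat.pow_log_le_self 2 hn
  have h2 : n ≤ 2 ^ (Nat.log 2 n + 1) := (Nat.lt_pow_succ_log_self (by norm_num) n).le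
  have h1' : (2:ℝ) ^ Nat.log 2 n ≤ n := by exact_mod_cast h1
  have h2' : (n:ℝ) ≤ (2:ℝ) ^ (Nat.log 2 n + 1) := by exact_mod_cast h2
  unfold Xsum Zsum
  calc _ ≤ ∑ i ∈ Finset.range (K * n + 1), ∑ k ∈ Finset.range ⌈((2:ℝ) ^ (Nat.log 2 n + 1)) ^ θ⌉₊,
        mLeb (retSet γ (shift^[i] ω) (k+1) (r / 2 ^ (Nat.log 2 n)) x0) := by
        refine Finset.sum_le_sum fun i _ => ?_
        calc _ ≤ ∑ k ∈ Finset.range ⌈(n:ℝ) ^ θ⌉₊,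
              mLeb (retSet γ (shift^[i] ω) (k+1) (r / 2 ^ (Nat.log 2 n)) x0) := by
              refine Finset.sum_le_sum fun k _ => measure_mono (retSet_mono _ _ _ ?_ _)
              gcongr
          _ ≤ _ := by
              refine Finset.sum_le_sum_of_subset (Finset.range_mono ?_)
              apply Nat.ceil_mono
              gcongr
    _ ≤ _ := by
        refine Finset.sum_le_sum_of_subset (Finset.range_mono ?_)
        gcongr

lemma measurable_Zsum (γ : Fin m → ℝ) (θ : ℝ) (r K l : ℕ) :
    Measurable (fun p : ℝ × Om m => Zsum γ θ r K l p.1 p.2) := by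
  unfold Zsum
  refine Finset.measurable_sum _ fun i _ => Finset.measurable_sum _ fun k _ => ?_
  exact measurable_ret γ i (k+1) _

lemma measurable_Zsum_tsum (γ : Fin m → ℝ) (θ : ℝ) (r K l0 : ℕ) :
    Measurable (fun p : ℝ × Om m => ∑' l, Zsum γ θ r K (l + l0) p.1 p.2) :=
  Measurable.tsum fun l => measurable_Zsum γ θ r K (l + l0)

lemma measurable_Zsum_left (γ : Fin m → ℝ) (θ : ℝ) (r K l : ℕ) (ω : Om m) :
    Measurable (fun x0 => Zsum γ θ r K l x0 ω) :=
  Measurable.comp (g := fun p : ℝ × Om m => Zsum γ θ r K l p.1 p.2) (f := fun x0 => (x0, ω))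
    (measurable_Zsum γ θ r K l) measurable_prodMk_right

lemma measurable_Zsum_tsum_right (γ : Fin m → ℝ) (θ : ℝ) (r K l0 : ℕ) (x0 : ℝ) :
    Measurable (fun ω : Om m => ∑' l, Zsum γ θ r K (l + l0) x0 ω) :=
  Measurable.comp (g := fun p : ℝ × Om m => ∑' l, Zsum γ θ r K (l + l0) p.1 p.2)
    (f := fun ω => (x0, ω)) (measurable_Zsum_tsum γ θ r K l0) measurable_prodMk_left

lemma lintegral_Zsum {γ : Fin m → ℝ} (hγ : ∀ i, γ i ∈ Ioo (0:ℝ) 1) {g : ℝ} (hg : ∀ i, γ i ≤ g)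
    (hg0 : 0 < g) {θ : ℝ} (hθ : 0 < θ) (hθ1 : θ < 1) (r K l : ℕ) (ω : Om m) {δ : ℝ} (hδ : 0 < δ) (hδ1 : δ ≤ 1)
    (hl : (r:ℝ) / 2 ^ l ≤ δ) :
    ∫⁻ x0 in Icc (2 * δ) 1, Zsum γ θ r K l x0 ω ≤
      ENNReal.ofReal (32 * (K + 1) * Kret g δ * r ^ 2 * ((2:ℝ) ^ (θ - 1)) ^ l) := by
  have hm1 : ∀ i k, Measurable fun x0 => mLeb (retSet γ (shift^[i] ω) k (r / 2 ^ l) x0) :=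
    fun i k => (measurable_ret γ i k _).comp (measurable_id.prodMk measurable_const)
  unfold Zsum
  rw [lintegral_finsetSum _ (fun i _ => Finset.measurable_sum _ fun k _ => hm1 i (k+1))]
  have hK := Kret_pos (g := g) hδ
  have hρ : 0 ≤ (r:ℝ) / 2 ^ l := by positivity
  set c := Kret g δ * (2 * ((r:ℝ) / 2 ^ l)) * (2 * ((r:ℝ) / 2 ^ l)) with hc
  have hc0 : 0 ≤ c := by positivity
  calc _ ≤ ∑ i ∈ Finset.range (K * 2 ^ (l + 1) + 1), ∑ k ∈ Finset.range ⌈((2:ℝ) ^ (l + 1)) ^ θ⌉₊,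
        ENNReal.ofReal c := by
        refine Finset.sum_le_sum fun i _ => ?_
        rw [lintegral_finsetSum _ (fun k _ => hm1 i (k+1))]
        exact Finset.sum_le_sum fun k _ => lintegral_ret hγ hg hg0 _ k hδ hδ1 hρ hl
    _ = ENNReal.ofReal (((K * 2 ^ (l + 1) + 1 : ℕ) : ℝ) * (⌈((2:ℝ) ^ (l + 1)) ^ θ⌉₊ * c)) := by
        simp only [Finset.sum_const, Finset.card_range, nsmul_eq_mul]
        rw [ENNReal.ofReal_mul (p := ((K * 2 ^ (l + 1) + 1 : ℕ) : ℝ)) (by positivity),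
          ENNReal.ofReal_mul (p := (⌈((2:ℝ) ^ (l + 1)) ^ θ⌉₊ : ℝ)) (by positivity),
          ENNReal.ofReal_natCast, ENNReal.ofReal_natCast]
    _ ≤ _ := by
        apply ENNReal.ofReal_le_ofReal
        have h2l : (1:ℝ) ≤ 2 ^ (l+1) := one_le_pow₀ (by norm_num)
        have e1 : ((K * 2 ^ (l + 1) + 1 : ℕ) : ℝ) ≤ (K + 1) * 2 ^ (l + 1) := by
          push_cast; nlinarith
        have h3 : (1:ℝ) ≤ ((2:ℝ) ^ (l + 1)) ^ θ := Real.one_le_rpow h2l hθ.le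
        have e2 : (⌈((2:ℝ) ^ (l + 1)) ^ θ⌉₊ : ℝ) ≤ 2 * ((2:ℝ) ^ (l + 1)) ^ θ := by
          have := Nat.ceil_lt_add_one (a := ((2:ℝ) ^ (l + 1)) ^ θ) (by positivity)
          linarith
        have e3 : ((2:ℝ) ^ (l + 1)) ^ θ = 2 ^ θ * ((2:ℝ) ^ θ) ^ l := by
          rw [pow_succ', Real.mul_rpow (by norm_num) (by positivity), ← Real.rpow_natCast 2 l,
            ← Real.rpow_natCast (2 ^ θ) l, ← Real.rpow_mul (by norm_num),
            ← Real.rpow_mul (by norm_num), mul_comm θ]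
        have e4 : (2:ℝ) ^ (θ - 1) = 2 ^ θ / 2 := by
          rw [Real.rpow_sub (by norm_num), Real.rpow_one]
        have e5 : (2:ℝ) ^ θ ≤ 2 := by
          calc (2:ℝ) ^ θ ≤ 2 ^ (1:ℝ) := Real.rpow_le_rpow_of_exponent_le (by norm_num) hθ1.le
            _ = 2 := Real.rpow_one 2
        calc _ ≤ ((K + 1) * 2 ^ (l + 1)) * ((2 * (2 * ((2:ℝ) ^ θ) ^ l)) * c) := by
              have : (⌈((2:ℝ) ^ (l + 1)) ^ θ⌉₊ : ℝ) ≤ 2 * (2 * ((2:ℝ) ^ θ) ^ l) := by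
                refine e2.trans ?_
                rw [e3]
                gcongr
              gcongr
          _ = _ := by
              rw [hc, e4, div_pow, pow_succ]
              field_simp
              ring

lemma ae_Xsum {γ : Fin m → ℝ} (hγ : ∀ i, γ i ∈ Ioo (0:ℝ) 1) {g : ℝ} (hg : ∀ i, γ i ≤ g)
    (hg0 : 0 < g) {θ : ℝ} (hθ : 0 < θ) (hθ1 : θ < 1) (P : Measure (Om m))
    [IsProbabilityMeasure P] :
    ∀ᵐ x0 ∂mLeb, ∀ r K : ℕ, ∀ᵐ ω ∂P, Tendsto (fun n => Xsum γ θ r K n x0 ω) atTop (𝓝 0) := by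
  rw [ae_all_iff]; intro r
  rw [ae_all_iff]; intro K
  have main : ∀ j : ℕ, ∀ᵐ x0, x0 ∈ Icc (2 * (1 / ((j:ℝ) + 1))) 1 →
      ∀ᵐ ω ∂P, Tendsto (fun n => Xsum γ θ r K n x0 ω) atTop (𝓝 0) := by
    intro j
    set δ : ℝ := 1 / ((j:ℝ) + 1) with hδdef
    have hδ : 0 < δ := by positivity
    have hδ1 : δ ≤ 1 := by
      rw [hδdef, div_le_one (by positivity)]
      have : (0:ℝ) ≤ j := Nat.cast_nonneg j
      linarith
    rw [← ae_restrict_iff' measurableSet_Icc]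
    obtain ⟨l0, hl0⟩ : ∃ l0 : ℕ, ∀ l, l0 ≤ l → (r:ℝ) / 2 ^ l ≤ δ := by
      have : Tendsto (fun l : ℕ => (r:ℝ) / 2 ^ l) atTop (𝓝 0) :=
        tendsto_const_nhds.div_atTop (tendsto_pow_atTop_atTop_of_one_lt (by norm_num))
      have h := this.eventually (gt_mem_nhds hδ)
      obtain ⟨l0, h0⟩ := eventually_atTop.1 h
      exact ⟨l0, fun l hl => (h0 l hl).le⟩
    set c : ℝ := 32 * (K + 1) * Kret g δ * r ^ 2 with hc
    have hc0 : 0 ≤ c := by have := Kret_pos (g := g) hδ; positivity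
    set q : ℝ := (2:ℝ) ^ (θ - 1) with hq
    have hq0 : 0 < q := by positivity
    have hq1 : q < 1 := Real.rpow_lt_one_of_one_lt_of_neg (by norm_num) (by linarith)
    set μ := volume.restrict (Icc (2 * δ) 1) with hμ
    have hfin : ∫⁻ x0, ∫⁻ ω, ∑' l, Zsum γ θ r K (l + l0) x0 ω ∂P ∂μ ≠ ∞ := by
      have hsm : Summable fun l : ℕ => c * q ^ (l + l0) :=
        ((summable_nat_add_iff l0).2 (summable_geometric_of_lt_one hq0.le hq1)).mul_left c
      have hmeas := measurable_Zsum_tsum γ θ r K l0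
      rw [lintegral_lintegral_swap hmeas.aemeasurable]
      refine ne_top_of_le_ne_top (b := ∫⁻ ω, ∑' l : ℕ, ENNReal.ofReal (c * q ^ (l + l0)) ∂P) ?_ ?_
      · rw [lintegral_const, measure_univ, mul_one]
        exact hsm.tsum_ofReal_ne_top
      · refine lintegral_mono fun ω => ?_
        rw [lintegral_tsum (fun l => (measurable_Zsum_left γ θ r K (l + l0) ω).aemeasurable)]
        exact ENNReal.tsum_le_tsum fun l => lintegral_Zsum hγ hg hg0 hθ hθ1 r K (l + l0) ω hδ hδ1
          (hl0 _ (by omega))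
    have hmeas := measurable_Zsum_tsum γ θ r K l0
    have h1 := ae_lt_top (Measurable.lintegral_prod_right' (ν := P) hmeas) hfin
    filter_upwards [h1] with x0 hx0
    have h2 := ae_lt_top (measurable_Zsum_tsum_right γ θ r K l0 x0) hx0.ne
    filter_upwards [h2] with ω hω
    have h3 : Tendsto (fun l => Zsum γ θ r K (l + l0) x0 ω) atTop (𝓝 0) :=
      ENNReal.tendsto_atTop_zero_of_tsum_ne_top hω.ne
    have h4 : Tendsto (fun l => Zsum γ θ r K l x0 ω) atTop (𝓝 0) :=
      (tendsto_add_atTop_iff_nat l0).1 h3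
    have h5 : Tendsto (fun n => Nat.log 2 n) atTop atTop := by
      refine tendsto_atTop_atTop.2 fun b => ⟨2 ^ b, fun a ha => ?_⟩
      exact Nat.le_log_of_pow_le (by norm_num) ha
    refine tendsto_of_tendsto_of_tendsto_of_le_of_le' tendsto_const_nhds (h4.comp h5)
      (Eventually.of_forall fun _ => zero_le) ?_
    filter_upwards [eventually_ne_atTop 0] with n hn
    exact Xsum_le_Zsum γ hθ r K hn x0 ω
  have hall := ae_all_iff.2 main
  unfold mLeb
  rw [ae_restrict_iff' measurableSet_Icc]
  have hne : ∀ᵐ x0 : ℝ, x0 ≠ 0 := by simp [ae_iff]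
  filter_upwards [hall, hne] with x0 h1 h2 hx0
  have hpos : 0 < x0 := lt_of_le_of_ne hx0.1 h2.symm
  obtain ⟨j, hj⟩ := exists_nat_one_div_lt (show 0 < x0 / 2 by linarith)
  exact h1 j ⟨by linarith, hx0.2⟩

end dyn2


section prob
variable {m : ℕ}

/-- the Bernoulli marginal -/
def marg (p : Fin m → ℝ) : Measure (Fin m) := ∑ i, ENNReal.ofReal (p i) • Measure.dirac i

lemma marg_singleton (p : Fin m → ℝ) (i : Fin m) : marg p {i} = ENNReal.ofReal (p i) := by
  simp [marg, Measure.finsetSum_apply, Set.indicator_apply, Finset.sum_ite_eq]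

lemma marg_prob {p : Fin m → ℝ} (hp : ∀ i, 0 < p i) (hp1 : ∑ i, p i = 1) :
    IsProbabilityMeasure (marg p) := by
  constructor
  simp only [marg, Measure.finsetSum_apply, Measure.smul_apply, measure_univ, smul_eq_mul, mul_one]
  rw [← ENNReal.ofReal_sum_of_nonneg (fun i _ => (hp i).le), hp1, ENNReal.ofReal_one]

lemma bern_eq {p : Fin m → ℝ} (hp : ∀ i, 0 < p i) (hp1 : ∑ i, p i = 1)
    (P : Measure (Om m)) [IsProbabilityMeasure P]
    (hP : ∀ (s : Finset ℤ) (f : ℤ → Fin m),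
      P {ω | ∀ i ∈ s, ω i = f i} = ENNReal.ofReal (∏ i ∈ s, p (f i))) :
    P = Measure.infinitePi (fun _ : ℤ => marg p) := by
  haveI := marg_prob hp hp1
  obtain ⟨ω0⟩ : Nonempty (Om m) := by
    by_contra h
    rw [not_nonempty_iff] at h
    have := measure_univ (μ := P)
    rw [univ_eq_empty_iff.2 h, measure_empty] at this
    exact zero_ne_one this
  refine IsProjectiveLimit.unique ?_
    (Measure.isProjectiveLimit_infinitePi (fun _ : ℤ => marg p))
  intro s
  refine Measure.ext_of_singleton fun f => ?_
  rw [Measure.map_apply (Finset.measurable_restrict s) (measurableSet_singleton f),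
    Measure.pi_singleton]
  have h1 : (Finset.restrict (π := fun _ : ℤ => Fin m) s) ⁻¹' ({f} : Set ((i : s) → Fin m)) = {ω : Om m | ∀ i ∈ s, ω i = (fun i => if h : i ∈ s then f ⟨i, h⟩ else ω0 i) i} := by
    ext ω
    simp only [mem_preimage, mem_singleton_iff, mem_setOf_eq]
    constructor
    · rintro rfl i hi
      simp [hi]
    · intro h
      ext ⟨i, hi⟩
      simp [h i hi, hi]
  rw [h1, hP, ENNReal.ofReal_prod_of_nonneg (fun i _ => (hp _).le)]
  simp only [marg_singleton]
  rw [← Finset.prod_attach, Finset.univ_eq_attach]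
  refine Finset.prod_congr rfl fun i _ => ?_
  simp

lemma bern_indep {p : Fin m → ℝ} (hp : ∀ i, 0 < p i) (hp1 : ∑ i, p i = 1)
    (P : Measure (Om m)) [IsProbabilityMeasure P]
    (hP : ∀ (s : Finset ℤ) (f : ℤ → Fin m),
      P {ω | ∀ i ∈ s, ω i = f i} = ENNReal.ofReal (∏ i ∈ s, p (f i))) :
    ProbabilityTheory.iIndepFun (fun (i : ℤ) (ω : Om m) => ω i) P := by
  haveI := marg_prob hp hp1
  rw [bern_eq hp hp1 P hP]
  exact ProbabilityTheory.iIndepFun_infinitePi (X := fun _ x => x) (fun _ => measurable_id)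

lemma bern_shift {p : Fin m → ℝ} (hp : ∀ i, 0 < p i) (hp1 : ∑ i, p i = 1)
    (P : Measure (Om m)) [IsProbabilityMeasure P]
    (hP : ∀ (s : Finset ℤ) (f : ℤ → Fin m),
      P {ω | ∀ i ∈ s, ω i = f i} = ENNReal.ofReal (∏ i ∈ s, p (f i))) (k : ℕ) :
    P.map (shift^[k]) = P := by
  haveI : IsProbabilityMeasure (P.map (shift^[k] : Om m → Om m)) :=
    Measure.isProbabilityMeasure_map (measurable_shift_iterate k).aemeasurable
  rw [bern_eq hp hp1 (P.map (shift^[k])) ?_, ← bern_eq hp hp1 P hP]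
  intro s f
  have hm : MeasurableSet {ω : Om m | ∀ i ∈ s, ω i = f i} := by
    have : {ω : Om m | ∀ i ∈ s, ω i = f i} = ⋂ i ∈ s, (fun ω : Om m => ω i) ⁻¹' {f i} := by
      ext; simp
    rw [this]
    exact Finset.measurableSet_biInter _ fun i _ =>
      measurable_pi_apply i (measurableSet_singleton _)
  rw [Measure.map_apply (measurable_shift_iterate k) hm]
  have h1 : (shift^[k]) ⁻¹' {ω : Om m | ∀ i ∈ s, ω i = f i} =
      {ω : Om m | ∀ i ∈ s.map (addRightEmbedding (k:ℤ)), ω i = (fun i => f (i - k)) i} := by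
    ext ω
    simp [shift_iterate]
  rw [h1, hP]
  simp

lemma sum_blocks (a : ℕ → ℝ) (L J : ℕ) :
    ∑ k ∈ Finset.range (L * J), a k =
      ∑ r ∈ Finset.range L, ∑ j ∈ Finset.range J, a (L * j + r) := by
  induction J with
  | zero => simp
  | succ n ih =>
    rw [Nat.mul_succ, Finset.sum_range_add, ih]
    simp_rw [Finset.sum_range_succ]
    rw [Finset.sum_add_distrib]

lemma avg_blocks (a : ℕ → ℝ) {B c : ℝ} (hB : ∀ k, |a k| ≤ B) {L : ℕ} (hL : 1 ≤ L)
    (h : ∀ r < L, Tendsto (fun J : ℕ => (∑ j ∈ Finset.range J, a (L * j + r)) / J) atTop (𝓝 c)) :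
    Tendsto (fun M : ℕ => (∑ k ∈ Finset.range M, a k) / M) atTop (𝓝 c) := by
  have hB0 : 0 ≤ B := (abs_nonneg _).trans (hB 0)
  have hL0 : (0:ℝ) < L := by exact_mod_cast hL
  have h1 : Tendsto (fun J : ℕ => (∑ k ∈ Finset.range (L * J), a k) / J) atTop (𝓝 (L * c)) := by
    have h2 : Tendsto (fun J : ℕ => ∑ r ∈ Finset.range L,
        (∑ j ∈ Finset.range J, a (L * j + r)) / J) atTop (𝓝 (∑ _r ∈ Finset.range L, c)) :=
      tendsto_finsetSum _ fun r hr => h r (Finset.mem_range.1 hr)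
    simp only [Finset.sum_const, Finset.card_range, nsmul_eq_mul] at h2
    refine h2.congr fun J => ?_
    rw [sum_blocks, Finset.sum_div]
  have hdiv : Tendsto (fun M : ℕ => M / L) atTop atTop :=
    Nat.tendsto_div_const_atTop (by omega)
  have h3 := h1.comp hdiv
  have hcd : ∀ D : ℝ, Tendsto (fun M : ℕ => D / (M:ℝ)) atTop (𝓝 0) := fun D =>
    tendsto_const_div_atTop_nhds_zero_nat D
  -- (M / L) / M → 1 / L
  have h4 : Tendsto (fun M : ℕ => ((M / L : ℕ) : ℝ) / M) atTop (𝓝 (1 / L)) := by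
    have h5 : Tendsto (fun M : ℕ => (1 / (L:ℝ)) * (1 - ((M % L : ℕ) : ℝ) / M)) atTop
        (𝓝 ((1 / L) * (1 - 0))) := by
      refine (tendsto_const_nhds.sub ?_).const_mul _
      refine squeeze_zero (fun M => by positivity) (fun M => ?_) (hcd L)
      gcongr
      exact (Nat.mod_lt _ (by omega)).le
    rw [sub_zero, mul_one] at h5
    refine h5.congr' ?_
    filter_upwards [eventually_gt_atTop 0] with M hM
    have hM' : (0:ℝ) < M := by exact_mod_cast hM
    have := Nat.div_add_mod M L
    have h6 : (L:ℝ) * ((M / L : ℕ) : ℝ) + ((M % L : ℕ) : ℝ) = M := by exact_mod_cast this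
    field_simp
    linarith
  have h7 := h3.mul h4
  have h8 : Tendsto (fun M : ℕ => ((∑ k ∈ Finset.range M, a k) -
      ∑ k ∈ Finset.range (L * (M / L)), a k) / M) atTop (𝓝 0) := by
    refine squeeze_zero_norm (fun M => ?_) (hcd (L * B))
    rw [Real.norm_eq_abs, abs_div, Nat.abs_cast]
    gcongr
    have e : M = L * (M / L) + M % L := (Nat.div_add_mod M L).symm
    have : ∑ k ∈ Finset.range M, a k = ∑ k ∈ Finset.range (L * (M / L)), a k +
        ∑ k ∈ Finset.range (M % L), a (L * (M / L) + k) := by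
      conv_lhs => rw [e]
      rw [Finset.sum_range_add]
    rw [this, add_sub_cancel_left]
    calc _ ≤ ∑ k ∈ Finset.range (M % L), |a (L * (M / L) + k)| := Finset.abs_sum_le_sum_abs _ _
      _ ≤ ∑ k ∈ Finset.range (M % L), B := Finset.sum_le_sum fun k _ => hB _
      _ = ((M % L : ℕ) : ℝ) * B := by simp
      _ ≤ L * B := by
        gcongr
        exact (Nat.mod_lt _ (by omega)).le
  have h9 := h7.add h8
  have e1 : (L:ℝ) * c * (1 / L) + 0 = c := by field_simp; ring
  rw [e1] at h9
  refine h9.congr' ?_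
  have hev : ∀ᶠ M : ℕ in atTop, 0 < M / L := hdiv.eventually (eventually_gt_atTop 0)
  filter_upwards [hev, eventually_gt_atTop 0] with M h10 hM
  have hM' : (0:ℝ) < M := by exact_mod_cast hM
  have h10' : (0:ℝ) < ((M / L : ℕ) : ℝ) := by exact_mod_cast h10
  simp only [Function.comp]
  field_simp
  ring

/-- `F` depends only on the coordinates `-L ≤ i < 0`. -/
def IsLocal (L : ℕ) (F : Om m → ℝ) : Prop :=
  ∀ ω ω' : Om m, (∀ i : ℤ, -(L:ℤ) ≤ i → i < 0 → ω i = ω' i) → F ω = F ω'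

lemma birkhoff_local {p : Fin m → ℝ} (hp : ∀ i, 0 < p i) (hp1 : ∑ i, p i = 1)
    (P : Measure (Om m)) [IsProbabilityMeasure P]
    (hP : ∀ (s : Finset ℤ) (f : ℤ → Fin m),
      P {ω | ∀ i ∈ s, ω i = f i} = ENNReal.ofReal (∏ i ∈ s, p (f i)))
    {F : Om m → ℝ} (hF : Measurable F) {B : ℝ} (hB : ∀ ω, |F ω| ≤ B) {L : ℕ} (hL : 1 ≤ L)
    (hloc : IsLocal L F) :
    ∀ᵐ ω ∂P, Tendsto (fun M : ℕ => (∑ k ∈ Finset.range M, F (shift^[k] ω)) / M) atTop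
      (𝓝 (∫ ω, F ω ∂P)) := by
  have hIntg : Integrable F P :=
    Integrable.of_bound hF.aestronglyMeasurable B (Eventually.of_forall hB)
  have hmp : ∀ k, MeasurePreserving (shift^[k] : Om m → Om m) P P := fun k =>
    ⟨measurable_shift_iterate k, bern_shift hp hp1 P hP k⟩
  have hind := bern_indep hp hp1 P hP
  obtain ⟨ω0⟩ : Nonempty (Om m) := by
    by_contra h
    rw [not_nonempty_iff] at h
    have := measure_univ (μ := P)
    rw [univ_eq_empty_iff.2 h, measure_empty] at this
    exact zero_ne_one this
  -- dependence on a finite block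
  let S : ℕ → Finset ℤ := fun k => Finset.Ico ((k:ℤ) - L) k
  let ext : (k : ℕ) → ((i : S k) → Fin m) → Om m := fun k t i =>
    if h : i + k ∈ S k then t ⟨i + k, h⟩ else ω0 i
  have hFext : ∀ k ω, F (shift^[k] ω) = (fun t => F (ext k t)) (fun i : S k => ω i) := by
    intro k ω
    apply hloc
    intro i h1 h2
    have : i + k ∈ S k := by simp only [S, Finset.mem_Ico]; omega
    simp [ext, this, shift_iterate]
  have hpair : ∀ k l : ℕ, k + L ≤ l →
      ProbabilityTheory.IndepFun (fun ω => F (shift^[k] ω)) (fun ω => F (shift^[l] ω)) P := by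
    intro k l hkl
    have hd : Disjoint (S k) (S l) := by
      rw [Finset.disjoint_left]
      intro i hi hi'
      simp only [S, Finset.mem_Ico] at hi hi'
      omega
    have h := hind.indepFun_finset (S k) (S l) hd (fun i => measurable_pi_apply i)
    have h2 := h.comp (φ := fun t => F (ext k t)) (ψ := fun t => F (ext l t))
      Measurable.of_discrete Measurable.of_discrete
    have e1 : (fun ω => F (shift^[k] ω)) = (fun t => F (ext k t)) ∘ fun ω (i : S k) => ω i := by
      funext ω; exact hFext k ω
    have e2 : (fun ω => F (shift^[l] ω)) = (fun t => F (ext l t)) ∘ fun ω (i : S l) => ω i := by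
      funext ω; exact hFext l ω
    rw [e1, e2]
    exact h2
  have hr : ∀ r : ℕ, ∀ᵐ ω ∂P, Tendsto (fun J : ℕ =>
      (∑ j ∈ Finset.range J, F (shift^[L * j + r] ω)) / J) atTop (𝓝 (∫ ω, F ω ∂P)) := by
    intro r
    have hmean : ∫ ω, F (shift^[L * 0 + r] ω) ∂P = ∫ ω, F ω ∂P := by
      conv_rhs => rw [← bern_shift hp hp1 P hP (L * 0 + r)]
      rw [integral_map (measurable_shift_iterate _).aemeasurable hF.aestronglyMeasurable]
    rw [← hmean]
    refine ProbabilityTheory.strong_law_ae_real (fun j ω => F (shift^[L * j + r] ω)) ?_ ?_ ?_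
    · exact (hmp _).integrable_comp_of_integrable hIntg
    · intro i j hij
      rcases lt_or_gt_of_ne hij with h | h
      · refine hpair _ _ ?_
        have : L * (i + 1) ≤ L * j := Nat.mul_le_mul_left _ h
        rw [Nat.mul_succ] at this
        omega
      · refine (hpair _ _ ?_).symm
        have : L * (j + 1) ≤ L * i := Nat.mul_le_mul_left _ h
        rw [Nat.mul_succ] at this
        omega
    · intro i
      refine ⟨(hF.comp (measurable_shift_iterate _)).aemeasurable,
        (hF.comp (measurable_shift_iterate _)).aemeasurable, ?_⟩
      have e : ∀ k, P.map (fun ω => F (shift^[k] ω)) = P.map F := by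
        intro k
        conv_rhs => rw [← bern_shift hp hp1 P hP k]
        rw [Measure.map_map hF (measurable_shift_iterate _)]
        rfl
      rw [e, e]
  filter_upwards [ae_all_iff.2 hr] with ω hω
  exact avg_blocks (fun k => F (shift^[k] ω)) (fun k => hB _) hL fun r _ => hω r

lemma birkhoff_approx {p : Fin m → ℝ} (hp : ∀ i, 0 < p i) (hp1 : ∑ i, p i = 1)
    (P : Measure (Om m)) [IsProbabilityMeasure P]
    (hP : ∀ (s : Finset ℤ) (f : ℤ → Fin m),
      P {ω | ∀ i ∈ s, ω i = f i} = ENNReal.ofReal (∏ i ∈ s, p (f i)))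
    {f : Om m → ℝ} (hf : Measurable f) {B : ℝ} (hB : ∀ ω, |f ω| ≤ B)
    (happ : ∀ η : ℝ, 0 < η → ∃ (L : ℕ) (F : Om m → ℝ), 1 ≤ L ∧ IsLocal L F ∧ Measurable F ∧
      ∀ ω, |F ω - f ω| ≤ η) :
    ∀ᵐ ω ∂P, Tendsto (fun M : ℕ => (∑ k ∈ Finset.range M, f (shift^[k] ω)) / M) atTop
      (𝓝 (∫ ω, f ω ∂P)) := by
  choose L F hL hloc hF hFf using fun j : ℕ => happ (1 / ((j:ℝ) + 1)) (by positivity)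
  have hFB : ∀ j ω, |F j ω| ≤ B + 1 := by
    intro j ω
    have h1 := hFf j ω
    have h2 : 1 / ((j:ℝ) + 1) ≤ 1 := by
      rw [div_le_one (by positivity)]
      have : (0:ℝ) ≤ j := Nat.cast_nonneg j
      linarith
    have h3 := hB ω
    rw [abs_le] at *
    constructor <;> linarith [h1.1, h1.2, h3.1, h3.2]
  have hall := ae_all_iff.2 fun j =>
    birkhoff_local hp hp1 P hP (hF j) (hFB j) (hL j) (hloc j)
  have hfi : Integrable f P :=
    Integrable.of_bound hf.aestronglyMeasurable B (Eventually.of_forall hB)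
  filter_upwards [hall] with ω hω
  rw [Metric.tendsto_atTop]
  intro ε hε
  obtain ⟨j, hj⟩ := exists_nat_one_div_lt (show 0 < ε / 3 by linarith)
  obtain ⟨N, hN⟩ := Metric.tendsto_atTop.1 (hω j) (ε / 3) (by linarith)
  refine ⟨N + 1, fun M hM => ?_⟩
  have h1 := hN M (by omega)
  have hMpos : (0:ℝ) < M := by exact_mod_cast (by omega : 0 < M)
  have hFi : Integrable (F j) P :=
    Integrable.of_bound (hF j).aestronglyMeasurable (B+1) (Eventually.of_forall (hFB j))
  have h2 : |∫ ω, F j ω ∂P - ∫ ω, f ω ∂P| ≤ 1 / ((j:ℝ) + 1) := by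
    rw [← integral_sub hFi hfi]
    have := norm_integral_le_of_norm_le_const (μ := P) (f := fun ω => F j ω - f ω)
      (Eventually.of_forall fun ω => hFf j ω)
    simpa using this
  have h3 : |(∑ k ∈ Finset.range M, F j (shift^[k] ω)) / M -
      (∑ k ∈ Finset.range M, f (shift^[k] ω)) / M| ≤ 1 / ((j:ℝ) + 1) := by
    rw [← sub_div, ← Finset.sum_sub_distrib, abs_div, Nat.abs_cast, div_le_iff₀ hMpos]
    calc _ ≤ ∑ k ∈ Finset.range M, |F j (shift^[k] ω) - f (shift^[k] ω)| :=
          Finset.abs_sum_le_sum_abs _ _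
      _ ≤ ∑ k ∈ Finset.range M, 1 / ((j:ℝ) + 1) := Finset.sum_le_sum fun k _ => hFf j _
      _ = _ := by simp [mul_comm]
  rw [Real.dist_eq] at *
  rw [abs_le] at h2 h3
  rw [abs_lt] at *
  constructor <;> linarith [h1.1, h1.2, h2.1, h2.2, h3.1, h3.2]

end prob


section quenched
variable {m : ℕ}

/-- The standing assumptions on the quenched measures, bundled. -/
structure QSetup (γ : Fin m → ℝ) (ν : Om m → Measure ℝ) (h : Om m → ℝ → ℝ) (g a C : ℝ) : Prop where
  hγ : ∀ i, γ i ∈ Ioo (0:ℝ) 1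
  hg : ∀ i, γ i ≤ g
  g0 : 0 < g
  g3 : g < 1 / 3
  prob : ∀ ω, IsProbabilityMeasure (ν ω)
  hmeas : ∀ ω, Measurable (h ω)
  dens : ∀ ω, ν ω = mLeb.withDensity (fun x => ENNReal.ofReal (h ω x))
  equiv : ∀ ω : Om m, (ν ω).map (lsv (γ (ω 0))) = ν (shift ω)
  a0 : 0 < a
  nonneg : ∀ ω x, 0 ≤ h ω x
  anti : ∀ ω, AntitoneOn (h ω) (Ioc 0 1)
  mono : ∀ ω, MonotoneOn (fun x => x ^ (g + 1) * h ω x) (Ioc 0 1)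
  bdd : ∀ ω, ∀ x ∈ Ioc (0:ℝ) 1, h ω x ≤ a * x ^ (-g)
  C0 : 0 < C
  pull : ∀ (ω : Om m) (n : ℕ), 2 ≤ n →
      tvDist (mLeb.map (randComp (fun i => lsv (γ i)) (shiftInv^[n] ω) n)) (ν ω) ≤
        C * (n : ℝ) ^ (1 - 1 / g) * (Real.log n) ^ (1 / g)
  dec : ∀ f : ℝ → ℝ, ContDiff ℝ 1 f → ∀ (ω : Om m) (N : ℕ), 2 ≤ N →
      (SignedMeasure.totalVariation
        (((ν ω).withDensityᵥ (fun x => f x - ∫ y, f y ∂(ν ω))).map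
          (randComp (fun i => lsv (γ i)) ω N)) Set.univ).toReal ≤
        C * C1norm f * (N : ℝ) ^ (1 - 1 / g) * (Real.log N) ^ (1 / g)

variable {γ : Fin m → ℝ} {ν : Om m → Measure ℝ} {h : Om m → ℝ → ℝ} {g a C : ℝ}

lemma rate_bound (g0 : 0 < g) (g3 : g < 1 / 3) :
    ∃ C2 β : ℝ, 0 < C2 ∧ 2 < β ∧ ∀ N : ℕ, 2 ≤ N →
      (N : ℝ) ^ (1 - 1 / g) * (Real.log N) ^ (1 / g) ≤ C2 * (N : ℝ) ^ (-β) := by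
  have hg' : 3 < 1 / g := by rw [lt_div_iff₀ g0]; linarith
  set e : ℝ := g * (1 / g - 3) / 2 with he
  have e0 : 0 < e := by rw [he]; have := mul_pos g0 (sub_pos.2 hg'); linarith
  refine ⟨(1 / e) ^ (1 / g), (1 / g + 1) / 2, by positivity, by linarith, fun N hN => ?_⟩
  have hN0 : (0:ℝ) < N := by positivity
  have hN1 : (1:ℝ) ≤ N := by exact_mod_cast (by omega : 1 ≤ N)
  have h1 : Real.log N ≤ (N:ℝ) ^ e / e := Real.log_le_rpow_div hN0.le e0
  have h2 : (Real.log N) ^ (1 / g) ≤ ((N:ℝ) ^ e / e) ^ (1 / g) :=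
    Real.rpow_le_rpow (Real.log_nonneg hN1) h1 (by positivity)
  have h3 : ((N:ℝ) ^ e / e) ^ (1 / g) = (1 / e) ^ (1 / g) * (N:ℝ) ^ (e * (1 / g)) := by
    rw [Real.rpow_mul hN0.le, ← Real.mul_rpow (by positivity) (by positivity)]
    congr 1
    ring
  calc (N : ℝ) ^ (1 - 1 / g) * (Real.log N) ^ (1 / g)
      ≤ (N : ℝ) ^ (1 - 1 / g) * ((1 / e) ^ (1 / g) * (N:ℝ) ^ (e * (1 / g))) := by
        rw [← h3]; gcongr
    _ = (1 / e) ^ (1 / g) * ((N : ℝ) ^ (1 - 1 / g) * (N:ℝ) ^ (e * (1 / g))) := by ring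
    _ = _ := by
        rw [← Real.rpow_add hN0]
        congr 2
        rw [he]
        field_simp
        ring

lemma tv_le (μ η : Measure ℝ) [IsProbabilityMeasure μ] [IsProbabilityMeasure η] {A : Set ℝ}
    (hA : MeasurableSet A) : |μ.real A - η.real A| ≤ tvDist μ η := by
  have key : ∀ (μ η : Measure ℝ) [IsProbabilityMeasure μ] [IsProbabilityMeasure η]
      (A : {A : Set ℝ // MeasurableSet A}), (μ A).toReal - (η A).toReal ≤
      ⨆ A : {A : Set ℝ // MeasurableSet A}, ((μ A).toReal - (η A).toReal) := by
    intro μ η _ _ A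
    refine le_ciSup (f := fun A : {A : Set ℝ // MeasurableSet A} => (μ A).toReal - (η A).toReal)
      ⟨1, ?_⟩ A
    rintro _ ⟨B, rfl⟩
    have h1 : μ.real B ≤ 1 := measureReal_le_one
    have h2 : 0 ≤ η.real B := measureReal_nonneg
    simp only [Measure.real] at h1 h2
    simp only
    linarith
  have h0 := key μ η ⟨∅, MeasurableSet.empty⟩
  have h0' := key η μ ⟨∅, MeasurableSet.empty⟩
  have h1 := key μ η ⟨A, hA⟩
  have h1' := key η μ ⟨A, hA⟩
  simp only [measure_empty, ENNReal.toReal_zero, sub_zero] at h0 h0' h1 h1'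
  rw [abs_le, tvDist]
  simp only [Measure.real]
  constructor <;> linarith

lemma QSetup.map_iter (S : QSetup γ ν h g a C) (ω : Om m) (N : ℕ) :
    (ν ω).map (randComp (fun i => lsv (γ i)) ω N) = ν (shift^[N] ω) := by
  induction N with
  | zero =>
    simp only [Function.iterate_zero, id]
    exact Measure.map_id
  | succ N ih =>
    rw [Function.iterate_succ_apply', ← S.equiv, ← ih,
      Measure.map_map (measurable_lsv _) (measurable_randComp γ ω N)]
    congr 1
    funext x
    simp [randComp, shift_iterate]

lemma measurable_pullback (γ : Fin m → ℝ) (n : ℕ) {A : Set ℝ} (hA : MeasurableSet A) :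
    Measurable (fun ω : Om m =>
      (mLeb.map (randComp (fun i => lsv (γ i)) (shiftInv^[n] ω) n)).real A) := by
  have h1 : ∀ ω : Om m, (mLeb.map (randComp (fun i => lsv (γ i)) (shiftInv^[n] ω) n)).real A =
      (mLeb (Prod.mk ω ⁻¹' {p : Om m × ℝ |
        randComp (fun i => lsv (γ i)) (shiftInv^[n] p.1) n p.2 ∈ A})).toReal := by
    intro ω
    rw [Measure.real, Measure.map_apply (measurable_randComp γ _ n) hA]
    rfl
  simp_rw [h1]
  refine Measurable.ennreal_toReal (measurable_measure_prodMk_left ?_)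
  have h2 : Measurable (fun p : Om m × ℝ =>
      randComp (fun i => lsv (γ i)) (shiftInv^[n] p.1) n p.2) :=
    Measurable.comp (g := fun p : Om m × ℝ => randComp (fun i => lsv (γ i)) p.1 n p.2)
      (f := fun p : Om m × ℝ => (shiftInv^[n] p.1, p.2))
      (measurable_randComp_joint γ n)
      (Measurable.prodMk ((measurable_shiftInv_iterate n).comp measurable_fst) measurable_snd)
  exact h2 hA

lemma local_pullback (γ : Fin m → ℝ) (n : ℕ) (A : Set ℝ) :
    IsLocal n (fun ω : Om m =>
      (mLeb.map (randComp (fun i => lsv (γ i)) (shiftInv^[n] ω) n)).real A) := by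
  intro ω ω' hω
  have : randComp (fun i => lsv (γ i)) (shiftInv^[n] ω) n =
      randComp (fun i => lsv (γ i)) (shiftInv^[n] ω') n := by
    funext x
    refine randComp_congr _ n (fun i hi => ?_) x
    rw [shiftInv_iterate, shiftInv_iterate]
    exact hω _ (by omega) (by omega)
  simp only [this]

lemma QSetup.approx (S : QSetup γ ν h g a C) {η : ℝ} (hη : 0 < η) :
    ∃ N0 : ℕ, ∀ n, N0 ≤ n → ∀ (ω : Om m) (A : Set ℝ), MeasurableSet A →
      |(mLeb.map (randComp (fun i => lsv (γ i)) (shiftInv^[n] ω) n)).real A - (ν ω).real A| ≤ η := by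
  obtain ⟨C2, β, hC2, hβ, hr⟩ := rate_bound S.g0 S.g3
  have hlim : Tendsto (fun n : ℕ => C * (C2 * (n:ℝ) ^ (-β))) atTop (𝓝 0) := by
    have := ((tendsto_rpow_neg_atTop (by linarith : 0 < β)).comp
      tendsto_natCast_atTop_atTop).const_mul C2 |>.const_mul C
    simpa using this
  obtain ⟨N0, hN0⟩ := eventually_atTop.1 ((hlim.eventually (gt_mem_nhds hη)).and
    (eventually_ge_atTop 2))
  refine ⟨N0, fun n hn ω A hA => ?_⟩
  haveI := S.prob ω
  haveI : IsProbabilityMeasure (mLeb.map (randComp (fun i => lsv (γ i)) (shiftInv^[n] ω) n)) :=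
    Measure.isProbabilityMeasure_map (measurable_randComp γ _ n).aemeasurable
  obtain ⟨h1, h2⟩ := hN0 n hn
  refine (tv_le _ _ hA).trans ((S.pull ω n h2).trans ?_)
  rw [mul_assoc]
  exact (mul_le_mul_of_nonneg_left (hr n h2) S.C0.le).trans h1.le

lemma QSetup.measurable_real (S : QSetup γ ν h g a C) {A : Set ℝ} (hA : MeasurableSet A) :
    Measurable (fun ω => (ν ω).real A) := by
  refine measurable_of_tendsto_metrizable (fun n => measurable_pullback γ n hA) ?_
  rw [tendsto_pi_nhds]
  intro ω
  rw [Metric.tendsto_atTop]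
  intro η hη
  obtain ⟨N0, hN0⟩ := S.approx (half_pos hη)
  refine ⟨N0, fun n hn => ?_⟩
  rw [Real.dist_eq]
  exact (hN0 n hn ω A hA).trans_lt (half_lt_self hη)

/-- upper bound of densities on `[δ,1]` -/
lemma QSetup.h_le (S : QSetup γ ν h g a C) {δ : ℝ} (hδ : 0 < δ) (ω : Om m) {x : ℝ}
    (hx : δ ≤ x) (hx1 : x ≤ 1) : h ω x ≤ a * δ ^ (-g) := by
  refine (S.bdd ω x ⟨hδ.trans_le hx, hx1⟩).trans ?_
  refine mul_le_mul_of_nonneg_left ?_ S.a0.le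
  exact Real.rpow_le_rpow_of_nonpos hδ hx (by linarith [S.g0])

lemma QSetup.meas_le (S : QSetup γ ν h g a C) {δ : ℝ} (hδ : 0 < δ) (ω : Om m) {A : Set ℝ}
    (hA : MeasurableSet A) (hAδ : A ⊆ Ici δ) :
    ν ω A ≤ ENNReal.ofReal (a * δ ^ (-g)) * mLeb A := by
  rw [S.dens ω, withDensity_apply _ hA, ← setLIntegral_const]
  refine setLIntegral_mono_ae measurable_const.aemeasurable ?_
  have : ∀ᵐ x ∂mLeb, x ∈ Icc (0:ℝ) 1 := ae_restrict_mem measurableSet_Icc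
  filter_upwards [this] with x hx hxA
  exact ENNReal.ofReal_le_ofReal (S.h_le hδ ω (hAδ hxA) hx.2)

/-- Lipschitz constant of the densities on `[δ,1]` -/
def LipC (a g δ : ℝ) : ℝ := 2 * (a * δ ^ (-g)) / δ ^ 2

lemma QSetup.lipC_pos (S : QSetup γ ν h g a C) {δ : ℝ} (hδ : 0 < δ) : 0 < LipC a g δ := by
  have := S.a0
  unfold LipC; positivity

lemma QSetup.lip_aux (S : QSetup γ ν h g a C) {δ : ℝ} (hδ : 0 < δ) (ω : Om m) {x y : ℝ}
    (hx : δ ≤ x) (hxy : x ≤ y) (hy1 : y ≤ 1) : |h ω x - h ω y| ≤ LipC a g δ * (y - x) := by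
  have hx0 := hδ.trans_le hx
  have hy0 := hx0.trans_le hxy
  have h1 : h ω y ≤ h ω x := S.anti ω ⟨hx0, hxy.trans hy1⟩ ⟨hy0, hy1⟩ hxy
  have h2 : x ^ (g + 1) * h ω x ≤ y ^ (g + 1) * h ω y :=
    S.mono ω ⟨hx0, hxy.trans hy1⟩ ⟨hy0, hy1⟩ hxy
  rw [abs_of_nonneg (by linarith)]
  have hM := S.h_le hδ ω (hx.trans hxy) hy1
  have hM0 : 0 < a * δ ^ (-g) := by have := S.a0; positivity
  have h3 : h ω x ≤ (y / x) ^ (g + 1) * h ω y := by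
    rw [Real.div_rpow hy0.le hx0.le, div_mul_eq_mul_div, le_div_iff₀ (by positivity)]
    linarith
  have hyx : 1 ≤ y / x := by rw [le_div_iff₀ hx0]; linarith
  have h4 : (y / x) ^ (g + 1) ≤ (y / x) ^ 2 := by
    rw [← Real.rpow_natCast]
    exact Real.rpow_le_rpow_of_exponent_le hyx (by have := S.g3; push_cast; linarith)
  have h5 : h ω x - h ω y ≤ ((y / x) ^ 2 - 1) * h ω y := by
    have := mul_le_mul_of_nonneg_right h4 (S.nonneg ω y)
    linarith
  have h6 : (y / x) ^ 2 - 1 ≤ 2 / δ ^ 2 * (y - x) := by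
    have e1 : (y / x) ^ 2 - 1 = (y - x) * ((y + x) / x ^ 2) := by
      field_simp; ring
    rw [e1, mul_comm (2 / δ ^ 2)]
    refine mul_le_mul_of_nonneg_left ?_ (by linarith)
    exact div_le_div₀ (by norm_num) (by linarith) (by positivity) (by gcongr)
  have h7 : 0 ≤ (y / x) ^ 2 - 1 := by nlinarith
  calc h ω x - h ω y ≤ ((y / x) ^ 2 - 1) * h ω y := h5
    _ ≤ (2 / δ ^ 2 * (y - x)) * (a * δ ^ (-g)) :=
      mul_le_mul h6 hM (S.nonneg ω y) (h7.trans h6)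
    _ = _ := by unfold LipC; ring

lemma QSetup.lip (S : QSetup γ ν h g a C) {δ : ℝ} (hδ : 0 < δ) (ω : Om m) {x y : ℝ}
    (hx : x ∈ Icc δ 1) (hy : y ∈ Icc δ 1) : |h ω x - h ω y| ≤ LipC a g δ * |x - y| := by
  rcases le_total x y with hxy | hxy
  · rw [abs_sub_comm x y, abs_of_nonneg (sub_nonneg.2 hxy)]
    exact S.lip_aux hδ ω hx.1 hxy hy.2
  · rw [abs_sub_comm, abs_of_nonneg (sub_nonneg.2 hxy)]
    exact S.lip_aux hδ ω hy.1 hxy hx.2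

/-- measure of small sets around `x0`. -/
lemma QSetup.meas_near (S : QSetup γ ν h g a C) {x0 ρ : ℝ} (hx0 : 0 < x0) 
    (hρ0 : 0 ≤ ρ) (hρ : ρ ≤ x0 / 2) (hρ1 : ρ ≤ 1 - x0) (ω : Om m) {A : Set ℝ}
    (hA : MeasurableSet A) (hAρ : A ⊆ Icc (x0 - ρ) (x0 + ρ)) :
    |(ν ω).real A - h ω x0 * volume.real A| ≤ LipC a g (x0 / 2) * ρ * volume.real A := by
  have hδ : 0 < x0 / 2 := by linarith
  set L := LipC a g (x0 / 2) with hL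
  have hL0 : 0 < L := S.lipC_pos hδ
  have hvol : volume A ≠ ∞ :=
    ((measure_mono hAρ).trans_lt (by simp)).ne
  have hh : ∀ x ∈ A, |h ω x - h ω x0| ≤ L * ρ := by
    intro x hx
    have hx' := hAρ hx
    refine (S.lip hδ ω (x := x) (y := x0) ⟨by linarith [hx'.1], by linarith [hx'.2]⟩
      ⟨by linarith, by linarith⟩).trans ?_
    refine mul_le_mul_of_nonneg_left ?_ hL0.le
    rw [abs_le]; constructor <;> linarith [hx'.1, hx'.2]
  have hr : ν ω A = ∫⁻ x in A, ENNReal.ofReal (h ω x) := by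
    rw [S.dens ω, withDensity_apply _ hA, mLeb, Measure.restrict_restrict hA]
    congr 2
    refine inter_eq_left.2 (hAρ.trans (Icc_subset_Icc (by linarith) (by linarith)))
  have hu : ν ω A ≤ ENNReal.ofReal (h ω x0 + L * ρ) * volume A := by
    rw [hr, ← setLIntegral_const]
    refine setLIntegral_mono measurable_const fun x hx => ?_
    exact ENNReal.ofReal_le_ofReal (by linarith [(abs_le.1 (hh x hx)).2])
  have hl : ENNReal.ofReal (h ω x0 - L * ρ) * volume A ≤ ν ω A := by
    rw [hr, ← setLIntegral_const]
    refine setLIntegral_mono (S.hmeas ω).ennreal_ofReal fun x hx => ?_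
    exact ENNReal.ofReal_le_ofReal (by linarith [(abs_le.1 (hh x hx)).1])
  haveI := S.prob ω
  have hu' := ENNReal.toReal_mono (ENNReal.mul_ne_top ENNReal.ofReal_ne_top hvol) hu
  have hl' := ENNReal.toReal_mono (measure_ne_top (ν ω) A) hl
  rw [ENNReal.toReal_mul, ENNReal.toReal_ofReal (by have := S.nonneg ω x0; positivity)] at hu'
  rw [ENNReal.toReal_mul] at hl'
  have hl'' : (h ω x0 - L * ρ) * (volume A).toReal ≤ (ν ω A).toReal :=
    (mul_le_mul_of_nonneg_right (by rw [ENNReal.toReal_ofReal']; exact le_max_left _ _)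
      ENNReal.toReal_nonneg).trans hl'
  simp only [Measure.real]
  rw [abs_le]
  constructor <;> nlinarith

lemma QSetup.h_pos (S : QSetup γ ν h g a C) (ω : Om m) {x0 : ℝ} (hx0 : x0 ∈ Ioo (0:ℝ) 1) :
    0 < h ω x0 := by
  by_contra hneg
  have hz : h ω x0 = 0 := le_antisymm (not_lt.1 hneg) (S.nonneg ω x0)
  have hall : ∀ x ∈ Ioc (0:ℝ) 1, h ω x = 0 := by
    intro x hx
    refine le_antisymm ?_ (S.nonneg ω x)
    rcases le_total x x0 with hxx | hxx
    · have := S.mono ω hx ⟨hx0.1, hx0.2.le⟩ hxx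
      simp only [hz, mul_zero] at this
      have hp : 0 < x ^ (g + 1) := Real.rpow_pos_of_pos hx.1 _
      by_contra hc
      push Not at hc
      have := mul_pos hp hc
      linarith
    · have := S.anti ω ⟨hx0.1, hx0.2.le⟩ hx hxx
      linarith
  haveI := S.prob ω
  have h1 := measure_univ (μ := ν ω)
  rw [S.dens ω, withDensity_apply _ MeasurableSet.univ, Measure.restrict_univ] at h1
  have h2 : ∫⁻ x, ENNReal.ofReal (h ω x) ∂mLeb = ∫⁻ x, 0 ∂mLeb := by
    refine lintegral_congr_ae ?_
    have e : mLeb = volume.restrict (Ioc (0:ℝ) 1) := by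
      rw [mLeb]; exact (Measure.restrict_congr_set Ioc_ae_eq_Icc).symm
    rw [e]
    filter_upwards [ae_restrict_mem measurableSet_Ioc] with x hx
    rw [hall x hx, ENNReal.ofReal_zero]
  rw [h2, lintegral_zero] at h1
  exact zero_ne_one h1

end quenched


section quenched2
variable {m : ℕ}
variable {γ : Fin m → ℝ} {ν : Om m → Measure ℝ} {h : Om m → ℝ → ℝ} {g a C : ℝ}

lemma QSetup.ball_near (S : QSetup γ ν h g a C) {x0 ρ : ℝ} (hx0 : 0 < x0)
    (hρ0 : 0 < ρ) (hρ : ρ ≤ x0 / 2) (hρ1 : ρ ≤ 1 - x0) (ω : Om m) :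
    |(ν ω).real (Ioo (x0 - ρ) (x0 + ρ)) / (2 * ρ) - h ω x0| ≤ LipC a g (x0 / 2) * ρ := by
  have h1 := S.meas_near hx0 hρ0.le hρ hρ1 ω (measurableSet_Ioo (a := x0 - ρ) (b := x0 + ρ))
    Ioo_subset_Icc_self
  have h2 : volume.real (Ioo (x0 - ρ) (x0 + ρ)) = 2 * ρ := by
    rw [Real.volume_real_Ioo_of_le (by linarith)]; ring
  rw [h2] at h1
  have h3 : (ν ω).real (Ioo (x0 - ρ) (x0 + ρ)) / (2 * ρ) - h ω x0 =
      ((ν ω).real (Ioo (x0 - ρ) (x0 + ρ)) - h ω x0 * (2 * ρ)) / (2 * ρ) := by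
    field_simp
  rw [h3, abs_div, abs_of_pos (by linarith : 0 < 2 * ρ), div_le_iff₀ (by linarith)]
  exact h1

lemma QSetup.exists_rho (S : QSetup γ ν h g a C) {x0 : ℝ} (hx0 : x0 ∈ Ioo (0:ℝ) 1) {η : ℝ}
    (hη : 0 < η) : ∃ ρ0 > 0, ∀ ρ, 0 < ρ → ρ ≤ ρ0 → ∀ ω,
    |(ν ω).real (Ioo (x0 - ρ) (x0 + ρ)) / (2 * ρ) - h ω x0| ≤ η := by
  have hL := S.lipC_pos (δ := x0 / 2) (by linarith [hx0.1])
  refine ⟨min (min (x0 / 2) (1 - x0)) (η / LipC a g (x0 / 2)), ?_, fun ρ hρ hρ' ω => ?_⟩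
  · refine lt_min (lt_min (by linarith [hx0.1]) (by linarith [hx0.2])) (by positivity)
  · refine (S.ball_near hx0.1 hρ (hρ'.trans ((min_le_left _ _).trans (min_le_left _ _)))
      (hρ'.trans ((min_le_left _ _).trans (min_le_right _ _))) ω).trans ?_
    have := hρ'.trans (min_le_right _ _)
    rw [le_div_iff₀ hL] at this
    linarith

lemma QSetup.measurable_h (S : QSetup γ ν h g a C) {x0 : ℝ} (hx0 : x0 ∈ Ioo (0:ℝ) 1) :
    Measurable (fun ω => h ω x0) := by
  refine measurable_of_tendsto_metrizable (f := fun (n : ℕ) ω =>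
    (ν ω).real (Ioo (x0 - 1 / ((n:ℝ) + 1)) (x0 + 1 / ((n:ℝ) + 1))) / (2 * (1 / ((n:ℝ) + 1))))
    (fun n => (S.measurable_real measurableSet_Ioo).div_const _) ?_
  rw [tendsto_pi_nhds]
  intro ω
  rw [Metric.tendsto_atTop]
  intro η hη
  obtain ⟨ρ0, hρ0, H⟩ := S.exists_rho hx0 (half_pos hη)
  obtain ⟨N, hN⟩ := exists_nat_one_div_lt hρ0
  refine ⟨N, fun n hn => ?_⟩
  rw [Real.dist_eq]
  refine (H _ (by positivity) (le_trans ?_ hN.le) ω).trans_lt (half_lt_self hη)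
  have : (N:ℝ) ≤ n := by exact_mod_cast hn
  gcongr

lemma QSetup.abs_h_le (S : QSetup γ ν h g a C) {x0 : ℝ} (hx0 : x0 ∈ Ioo (0:ℝ) 1) (ω : Om m) :
    |h ω x0| ≤ a * x0 ^ (-g) := by
  rw [abs_of_nonneg (S.nonneg ω x0)]
  exact S.h_le hx0.1 ω le_rfl hx0.2.le

lemma QSetup.integrable_h (S : QSetup γ ν h g a C) {x0 : ℝ} (hx0 : x0 ∈ Ioo (0:ℝ) 1)
    (P : Measure (Om m)) [IsProbabilityMeasure P] : Integrable (fun ω => h ω x0) P :=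
  Integrable.of_bound (S.measurable_h hx0).aestronglyMeasurable (a * x0 ^ (-g))
    (ae_of_all _ fun ω => by simpa using S.abs_h_le hx0 ω)

lemma QSetup.integral_h_pos (S : QSetup γ ν h g a C) {x0 : ℝ} (hx0 : x0 ∈ Ioo (0:ℝ) 1)
    (P : Measure (Om m)) [IsProbabilityMeasure P] : 0 < ∫ ω, h ω x0 ∂P := by
  rw [integral_pos_iff_support_of_nonneg (fun ω => S.nonneg ω x0) (S.integrable_h hx0 P)]
  have : Function.support (fun ω => h ω x0) = univ := by
    ext ω; simp [(S.h_pos ω hx0).ne']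
  rw [this, measure_univ]; exact one_pos

lemma QSetup.birkhoff_h (S : QSetup γ ν h g a C) {x0 : ℝ} (hx0 : x0 ∈ Ioo (0:ℝ) 1)
    {p : Fin m → ℝ} (hp : ∀ i, 0 < p i) (hp1 : ∑ i, p i = 1)
    (P : Measure (Om m)) [IsProbabilityMeasure P]
    (hP : ∀ (s : Finset ℤ) (f : ℤ → Fin m),
      P {ω | ∀ i ∈ s, ω i = f i} = ENNReal.ofReal (∏ i ∈ s, p (f i))) :
    ∀ᵐ ω ∂P, Tendsto (fun M : ℕ => (∑ k ∈ Finset.range M, h (shift^[k] ω) x0) / M) atTop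
      (𝓝 (∫ ω, h ω x0 ∂P)) := by
  refine birkhoff_approx hp hp1 P hP (S.measurable_h hx0) (S.abs_h_le hx0) fun η hη => ?_
  obtain ⟨ρ, hρ, H⟩ := S.exists_rho hx0 (half_pos hη)
  obtain ⟨N0, hN0⟩ := S.approx (mul_pos hρ hη)
  refine ⟨N0 + 1, fun ω => (mLeb.map (randComp (fun i => lsv (γ i)) (shiftInv^[N0 + 1] ω)
    (N0 + 1))).real (Ioo (x0 - ρ) (x0 + ρ)) / (2 * ρ), by omega, ?_,
    (measurable_pullback γ _ measurableSet_Ioo).div_const _, fun ω => ?_⟩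
  · intro ω ω' hω
    have := local_pullback γ (N0 + 1) (Ioo (x0 - ρ) (x0 + ρ)) ω ω' hω
    simp only at this ⊢
    rw [this]
  · have h1 := hN0 (N0 + 1) (by omega) ω (Ioo (x0 - ρ) (x0 + ρ)) measurableSet_Ioo
    have h2 := H ρ hρ le_rfl ω
    set F := (mLeb.map (randComp (fun i => lsv (γ i)) (shiftInv^[N0 + 1] ω)
      (N0 + 1))).real (Ioo (x0 - ρ) (x0 + ρ))
    set G := (ν ω).real (Ioo (x0 - ρ) (x0 + ρ))
    have h3 : |F / (2 * ρ) - G / (2 * ρ)| ≤ η / 2 := by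
      rw [← sub_div, abs_div, abs_of_pos (by linarith : 0 < 2 * ρ), div_le_iff₀ (by linarith)]
      linarith
    have e : F / (2 * ρ) - h ω x0 = (F / (2 * ρ) - G / (2 * ρ)) + (G / (2 * ρ) - h ω x0) := by ring
    rw [e]
    exact (abs_add_le _ _).trans (by linarith)

lemma QSetup.annealed (S : QSetup γ ν h g a C) {x0 : ℝ} (hx0 : x0 ∈ Ioo (0:ℝ) 1)
    (P : Measure (Om m)) [IsProbabilityMeasure P] (νa : Measure ℝ)
    (hνa : ∀ A : Set ℝ, MeasurableSet A → νa A = ∫⁻ ω, ν ω A ∂P) :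
    Tendsto (fun ε : ℝ => (νa {x | |x - x0| < ε}).toReal / ε) (𝓝[>] (0 : ℝ))
      (𝓝 (2 * ∫ ω, h ω x0 ∂P)) := by
  rw [Metric.tendsto_nhdsWithin_nhds]
  intro η hη
  obtain ⟨ρ0, hρ0, H⟩ := S.exists_rho hx0 (show 0 < η / 4 by linarith)
  refine ⟨ρ0, hρ0, fun {ε} hε hεd => ?_⟩
  have hε0 : 0 < ε := hε
  rw [Real.dist_eq, sub_zero, abs_of_pos hε0] at hεd
  have hset : {x | |x - x0| < ε} = Ioo (x0 - ε) (x0 + ε) := by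
    ext x
    simp only [mem_setOf_eq, mem_Ioo, abs_lt]
    constructor <;> rintro ⟨h1, h2⟩ <;> constructor <;> linarith
  rw [hset, hνa _ measurableSet_Ioo]
  set B := Ioo (x0 - ε) (x0 + ε)
  have hmeas : Measurable (fun ω => (ν ω).real B) := S.measurable_real measurableSet_Ioo
  have hle1 : ∀ ω, (ν ω).real B ≤ 1 := fun ω => by
    haveI := S.prob ω; exact measureReal_le_one
  have hIntg : Integrable (fun ω => (ν ω).real B) P :=
    Integrable.of_bound hmeas.aestronglyMeasurable 1
      (ae_of_all _ fun ω => by simpa [abs_of_nonneg measureReal_nonneg] using hle1 ω)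
  have e1 : (∫⁻ ω, ν ω B ∂P).toReal = ∫ ω, (ν ω).real B ∂P := by
    rw [integral_eq_lintegral_of_nonneg_ae (ae_of_all _ fun ω => measureReal_nonneg)
      hmeas.aestronglyMeasurable]
    congr 1
    refine lintegral_congr fun ω => ?_
    haveI := S.prob ω
    rw [Measure.real, ENNReal.ofReal_toReal (measure_ne_top _ _)]
  have e2 : (∫ ω, (ν ω).real B ∂P) / ε - 2 * ∫ ω, h ω x0 ∂P =
      2 * ∫ ω, ((ν ω).real B / (2 * ε) - h ω x0) ∂P := by
    rw [integral_sub (hIntg.div_const _) (S.integrable_h hx0 P), integral_div]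
    field_simp
  rw [e1, Real.dist_eq, e2, abs_mul, abs_of_pos (by norm_num : (0:ℝ) < 2)]
  have h3 : ‖∫ ω, ((ν ω).real B / (2 * ε) - h ω x0) ∂P‖ ≤ η / 4 := by
    refine (norm_integral_le_of_norm_le_const (C := η / 4)
      (ae_of_all _ fun ω => ?_)).trans (by simp)
    rw [Real.norm_eq_abs]
    exact H ε hε0 hεd.le ω
  rw [Real.norm_eq_abs] at h3
  linarith

end quenched2


section decor
variable {m : ℕ}
variable {γ : Fin m → ℝ} {ν : Om m → Measure ℝ} {h : Om m → ℝ → ℝ} {g a C : ℝ}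

lemma signed_abs_le (s : SignedMeasure ℝ) {A : Set ℝ} (hA : MeasurableSet A) :
    |s A| ≤ (s.totalVariation univ).toReal := by
  have h1 := s.apply_eq_posPart_real_sub_negPart_real hA
  have e : (s.totalVariation univ).toReal =
      s.toJordanDecomposition.posPart.real univ + s.toJordanDecomposition.negPart.real univ := by
    rw [SignedMeasure.totalVariation, Measure.add_apply, ENNReal.toReal_add (measure_ne_top _ _)
      (measure_ne_top _ _)]
    rfl
  have h2 : s.toJordanDecomposition.posPart.real A ≤ s.toJordanDecomposition.posPart.real univ :=
    measureReal_mono (subset_univ _)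
  have h3 : s.toJordanDecomposition.negPart.real A ≤ s.toJordanDecomposition.negPart.real univ :=
    measureReal_mono (subset_univ _)
  have h4 : 0 ≤ s.toJordanDecomposition.posPart.real A := measureReal_nonneg
  have h5 : 0 ≤ s.toJordanDecomposition.negPart.real A := measureReal_nonneg
  rw [h1, e, abs_le]
  constructor <;> linarith

lemma exists_deriv_bound : ∃ D : ℝ, 0 < D ∧ ∀ x, |deriv Real.smoothTransition x| ≤ D := by
  have hc : Continuous (deriv Real.smoothTransition) :=
    (Real.smoothTransition.contDiff (n := 1)).continuous_deriv le_rfl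
  obtain ⟨D, hD⟩ := (isCompact_Icc (a := (0:ℝ)) (b := 1)).exists_bound_of_continuousOn hc.continuousOn
  refine ⟨max D 1, by positivity, fun x => ?_⟩
  by_cases hx : x ∈ Icc (0:ℝ) 1
  · exact (hD x hx).trans (le_max_left _ _)
  · have : deriv Real.smoothTransition x = 0 := by
      rcases lt_or_ge x 0 with h0 | h0
      · have : Real.smoothTransition =ᶠ[𝓝 x] fun _ => 0 := by
          filter_upwards [gt_mem_nhds h0] with y hy
          exact Real.smoothTransition.zero_of_nonpos hy.le
        rw [this.deriv_eq, deriv_const]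
      · have h1 : 1 < x := by
          by_contra h1; exact hx ⟨h0, not_lt.1 h1⟩
        have : Real.smoothTransition =ᶠ[𝓝 x] fun _ => 1 := by
          filter_upwards [lt_mem_nhds h1] with y hy
          exact Real.smoothTransition.one_of_one_le hy.le
        rw [this.deriv_eq, deriv_const]
    rw [this, abs_zero]; positivity

/-- the smoothed indicator of `Iio c` -/
def cutoff (c η x : ℝ) : ℝ := Real.smoothTransition ((c - x) / η)

lemma cutoff_contDiff (c η : ℝ) : ContDiff ℝ 1 (cutoff c η) := by
  unfold cutoff
  exact Real.smoothTransition.contDiff.comp ((contDiff_const.sub contDiff_id).div_const _)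

lemma cutoff_nonneg (c η x : ℝ) : 0 ≤ cutoff c η x := Real.smoothTransition.nonneg _

lemma cutoff_le_one (c η x : ℝ) : cutoff c η x ≤ 1 := Real.smoothTransition.le_one _

lemma cutoff_C1 {D : ℝ} (hD : ∀ x, |deriv Real.smoothTransition x| ≤ D) (c : ℝ) {η : ℝ}
    (hη : 0 < η) : C1norm (cutoff c η) ≤ 1 + D / η := by
  haveI : Nonempty (Icc (0:ℝ) 1) := ⟨⟨0, by simp⟩⟩
  refine add_le_add (ciSup_le fun x => ?_) (ciSup_le fun x => ?_)
  · rw [abs_of_nonneg (cutoff_nonneg _ _ _)]; exact cutoff_le_one _ _ _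
  · have h1 : HasDerivAt (fun x : ℝ => (c - x) / η) (-1 / η) (x:ℝ) :=
      ((hasDerivAt_id (x:ℝ)).const_sub c).div_const η
    have h2 : HasDerivAt Real.smoothTransition (deriv Real.smoothTransition ((c - x) / η))
        ((c - x) / η) :=
      ((Real.smoothTransition.contDiff (n := 1)).differentiable (by simp) _).hasDerivAt
    have h3 : HasDerivAt (cutoff c η) _ (x:ℝ) := HasDerivAt.comp (x:ℝ) h2 h1
    rw [h3.deriv, abs_mul, abs_div, abs_neg, abs_one, abs_of_pos hη, mul_one_div]
    gcongr
    exact hD _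

/-- covariance of two events -/
def covS (μ : Measure ℝ) (Q X : Set ℝ) : ℝ := μ.real (X ∩ Q) - μ.real X * μ.real Q

lemma cutoff_ind {c η : ℝ} (hη : 0 < η) (x : ℝ) :
    |(Iio c).indicator (fun _ => (1:ℝ)) x - cutoff c η x| ≤
      (Icc (c - η) c).indicator (fun _ => (1:ℝ)) x := by
  by_cases hE : x ∈ Icc (c - η) c
  · rw [indicator_of_mem hE]
    have h1 := cutoff_nonneg c η x
    have h2 := cutoff_le_one c η x
    by_cases hx : x ∈ Iio c
    · rw [indicator_of_mem hx, abs_le]; constructor <;> linarith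
    · rw [indicator_of_notMem hx, abs_le]; constructor <;> linarith
  · rw [indicator_of_notMem hE]
    by_cases hx : x < c
    · have hx2 : x < c - η := by
        by_contra hc; exact hE ⟨not_lt.1 hc, hx.le⟩
      rw [indicator_of_mem (show x ∈ Iio c from hx), cutoff,
        Real.smoothTransition.one_of_one_le (by rw [le_div_iff₀ hη]; linarith)]
      simp
    · rw [indicator_of_notMem (show x ∉ Iio c from hx), cutoff,
        Real.smoothTransition.zero_of_nonpos
          (div_nonpos_of_nonpos_of_nonneg (by linarith) hη.le)]
      simp

lemma QSetup.dec_apply (S : QSetup γ ν h g a C) {f : ℝ → ℝ} (hf : ContDiff ℝ 1 f)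
    (hfb : ∀ x, |f x| ≤ 1) (ω : Om m) {N : ℕ} (hN : 2 ≤ N) {A : Set ℝ} (hA : MeasurableSet A) :
    |∫ x in (randComp (fun i => lsv (γ i)) ω N) ⁻¹' A, (f x - ∫ y, f y ∂(ν ω)) ∂(ν ω)| ≤
      C * C1norm f * (N : ℝ) ^ (1 - 1 / g) * (Real.log N) ^ (1 / g) := by
  haveI := S.prob ω
  refine le_trans ?_ (S.dec f hf ω N hN)
  have hIntg : Integrable f (ν ω) := Integrable.of_bound hf.continuous.aestronglyMeasurable 1
    (ae_of_all _ fun x => by simpa using hfb x)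
  have hIntg2 : Integrable (fun x => f x - ∫ y, f y ∂(ν ω)) (ν ω) := hIntg.sub (integrable_const _)
  have h1 := signed_abs_le (((ν ω).withDensityᵥ (fun x => f x - ∫ y, f y ∂(ν ω))).map
          (randComp (fun i => lsv (γ i)) ω N)) hA
  rwa [VectorMeasure.map_apply _ (measurable_randComp γ ω N) hA,
    withDensityᵥ_apply hIntg2 (measurable_randComp γ ω N hA)] at h1

lemma QSetup.cov_Iio (S : QSetup γ ν h g a C) {D : ℝ}
    (hD : ∀ x, |deriv Real.smoothTransition x| ≤ D) (ω : Om m) {N : ℕ} (hN : 2 ≤ N)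
    {A : Set ℝ} (hA : MeasurableSet A) (c : ℝ) {η : ℝ} (hη : 0 < η) :
    |covS (ν ω) ((randComp (fun i => lsv (γ i)) ω N) ⁻¹' A) (Iio c)| ≤
      C * (1 + D / η) * ((N : ℝ) ^ (1 - 1 / g) * (Real.log N) ^ (1 / g)) +
        2 * (ν ω).real (Icc (c - η) c) := by
  haveI := S.prob ω
  set Q := (randComp (fun i => lsv (γ i)) ω N) ⁻¹' A with hQ
  have hQm : MeasurableSet Q := measurable_randComp γ ω N hA
  have hfb : ∀ x, |cutoff c η x| ≤ 1 := fun x => by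
    rw [abs_of_nonneg (cutoff_nonneg _ _ _)]; exact cutoff_le_one _ _ _
  have hIntg : Integrable (cutoff c η) (ν ω) :=
    Integrable.of_bound (cutoff_contDiff c η).continuous.aestronglyMeasurable 1
    (ae_of_all _ fun x => by simpa using hfb x)
  have h1 := S.dec_apply (cutoff_contDiff c η) hfb ω hN hA
  rw [← hQ] at h1
  have hN1 : (1:ℝ) ≤ N := by exact_mod_cast (by omega : 1 ≤ N)
  have hr0 : 0 ≤ (N : ℝ) ^ (1 - 1 / g) * (Real.log N) ^ (1 / g) :=
    mul_nonneg (by positivity) (Real.rpow_nonneg (Real.log_nonneg hN1) _)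
  have h1' : |∫ x in Q, (cutoff c η x - ∫ y, cutoff c η y ∂(ν ω)) ∂(ν ω)| ≤
      C * (1 + D / η) * ((N : ℝ) ^ (1 - 1 / g) * (Real.log N) ^ (1 / g)) := by
    refine h1.trans ?_
    rw [mul_assoc]
    refine mul_le_mul_of_nonneg_right ?_ hr0
    exact mul_le_mul_of_nonneg_left (cutoff_C1 hD c hη) S.C0.le
  have e1 : ∫ x in Q, (cutoff c η x - ∫ y, cutoff c η y ∂(ν ω)) ∂(ν ω) =
      ∫ x in Q, cutoff c η x ∂(ν ω) - (∫ y, cutoff c η y ∂(ν ω)) * (ν ω).real Q := by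
    rw [integral_sub hIntg.integrableOn (integrable_const _)]
    simp [mul_comm]
  -- indicator integrals
  have hI : Integrable ((Iio c).indicator (fun _ => (1:ℝ))) (ν ω) :=
    (integrable_const 1).indicator measurableSet_Iio
  have hE : Integrable ((Icc (c - η) c).indicator (fun _ => (1:ℝ))) (ν ω) :=
    (integrable_const 1).indicator measurableSet_Icc
  have key : ∀ R : Set ℝ, MeasurableSet R →
      |(ν ω).real (Iio c ∩ R) - ∫ x in R, cutoff c η x ∂(ν ω)| ≤ (ν ω).real (Icc (c - η) c) := by
    intro R hR
    have e2 : (ν ω).real (Iio c ∩ R) = ∫ x in R, (Iio c).indicator (fun _ => (1:ℝ)) x ∂(ν ω) := by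
      rw [setIntegral_indicator measurableSet_Iio, setIntegral_const, inter_comm]
      simp
    have e3 : (ν ω).real (Icc (c - η) c) = ∫ x, (Icc (c - η) c).indicator (fun _ => (1:ℝ)) x ∂(ν ω) := by
      rw [integral_indicator measurableSet_Icc, setIntegral_const]
      simp
    rw [e2, e3, ← integral_sub hI.integrableOn hIntg.integrableOn]
    calc _ ≤ ∫ x in R, |(Iio c).indicator (fun _ => (1:ℝ)) x - cutoff c η x| ∂(ν ω) :=
          abs_integral_le_integral_abs
      _ ≤ ∫ x in R, (Icc (c - η) c).indicator (fun _ => (1:ℝ)) x ∂(ν ω) :=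
          setIntegral_mono (hI.sub hIntg).abs.integrableOn hE.integrableOn (cutoff_ind hη)
      _ ≤ _ := setIntegral_le_integral hE
          (ae_of_all _ fun x => indicator_nonneg (fun _ _ => zero_le_one) x)
  have k1 := key Q hQm
  have k2 := key univ MeasurableSet.univ
  rw [inter_univ, Measure.restrict_univ] at k2
  have q0 : 0 ≤ (ν ω).real Q := measureReal_nonneg
  have q1 : (ν ω).real Q ≤ 1 := measureReal_le_one
  have k3 : |((ν ω).real (Iio c) - ∫ x, cutoff c η x ∂(ν ω)) * (ν ω).real Q| ≤
      (ν ω).real (Icc (c - η) c) := by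
    rw [abs_mul, abs_of_nonneg q0]
    calc _ ≤ |(ν ω).real (Iio c) - ∫ x, cutoff c η x ∂(ν ω)| * 1 := by gcongr
      _ ≤ _ := by rw [mul_one]; exact k2
  rw [e1] at h1'
  rw [covS]
  rw [abs_le] at *
  constructor <;> nlinarith

lemma QSetup.cov_bound (S : QSetup γ ν h g a C) : ∃ K β : ℝ, 0 < K ∧ 2 < β ∧
    ∀ (δ : ℝ), 0 < δ → ∀ (ω : Om m) (N : ℕ), 2 ≤ N → ∀ A : Set ℝ, MeasurableSet A →
    ∀ c η : ℝ, 0 < η → η ≤ 1 → δ + η ≤ c →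
    |covS (ν ω) ((randComp (fun i => lsv (γ i)) ω N) ⁻¹' A) (Iio c)| ≤
      K * (N:ℝ) ^ (-β) / η + 2 * (a * δ ^ (-g)) * η := by
  obtain ⟨C2, β, hC2, hβ, hr⟩ := rate_bound S.g0 S.g3
  obtain ⟨D, hD0, hD⟩ := exists_deriv_bound
  have hC := S.C0
  refine ⟨C * (1 + D) * C2, β, by positivity, hβ, fun δ hδ ω N hN A hA c η hη hη1 hc => ?_⟩
  refine (S.cov_Iio hD ω hN hA c hη).trans (add_le_add ?_ ?_)
  · have h1 : 1 + D / η ≤ (1 + D) / η := by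
      rw [add_div]; gcongr; rw [le_div_iff₀ hη]; linarith
    calc _ ≤ C * ((1 + D) / η) * (C2 * (N:ℝ) ^ (-β)) := by
          have := hr N hN
          gcongr
      _ = _ := by ring
  · have hM0 : 0 < a * δ ^ (-g) := by have := S.a0; positivity
    have h1 := S.meas_le hδ ω (measurableSet_Icc (a := c - η) (b := c))
      (fun x hx => by have := hx.1; simp only [mem_Ici]; linarith)
    have h2 : mLeb (Icc (c - η) c) ≤ ENNReal.ofReal η := by
      refine (Measure.restrict_apply_le _ _).trans ?_
      rw [Real.volume_Icc]
      exact ENNReal.ofReal_le_ofReal (by linarith)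
    have h3 : (ν ω) (Icc (c - η) c) ≤ ENNReal.ofReal (a * δ ^ (-g) * η) := by
      rw [ENNReal.ofReal_mul hM0.le]
      exact h1.trans (by gcongr)
    have h4 := ENNReal.toReal_le_of_le_ofReal (by positivity) h3
    simp only [Measure.real]
    linarith

lemma covS_diff (μ : Measure ℝ) [IsProbabilityMeasure μ] (Q : Set ℝ) {X Y : Set ℝ}
    (hY : MeasurableSet Y) (hQ : MeasurableSet Q) (hYX : Y ⊆ X) :
    covS μ Q (X \ Y) = covS μ Q X - covS μ Q Y := by
  unfold covS
  have e1 : (X \ Y) ∩ Q = (X ∩ Q) \ (Y ∩ Q) := by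
    ext x; simp only [mem_inter_iff, mem_diff]; tauto
  rw [e1, measureReal_diff (inter_subset_inter_left _ hYX) (hY.inter hQ), measureReal_diff hYX hY]
  ring

lemma covS_union {ι : Type*} [Fintype ι] (μ : Measure ℝ) [IsProbabilityMeasure μ] {Q : Set ℝ}
    (hQ : MeasurableSet Q) {X : ι → Set ℝ}
    (hX : ∀ i, MeasurableSet (X i)) (hd : Pairwise (Function.onFun Disjoint X)) :
    covS μ Q (⋃ i, X i) = ∑ i, covS μ Q (X i) := by
  unfold covS
  rw [iUnion_inter, measureReal_iUnion_fintype hd hX, measureReal_iUnion_fintype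
    (fun i j hij => (hd hij).mono inter_subset_left inter_subset_left)
    (fun i => (hX i).inter hQ), Finset.sum_sub_distrib, Finset.sum_mul]

lemma covS_congr (μ : Measure ℝ) (Q : Set ℝ) {X Y : Set ℝ} (hXY : X =ᵐ[μ] Y) :
    covS μ Q X = covS μ Q Y := by
  unfold covS
  rw [measureReal_congr hXY, measureReal_congr (hXY.inter (ae_eq_refl Q))]

/-- decorrelation for finite disjoint unions of intervals -/
lemma QSetup.cov_union_bound (S : QSetup γ ν h g a C) {K β : ℝ}
    (hK : ∀ (δ : ℝ), 0 < δ → ∀ (ω : Om m) (N : ℕ), 2 ≤ N → ∀ A : Set ℝ, MeasurableSet A →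
    ∀ c η : ℝ, 0 < η → η ≤ 1 → δ + η ≤ c →
    |covS (ν ω) ((randComp (fun i => lsv (γ i)) ω N) ⁻¹' A) (Iio c)| ≤
      K * (N:ℝ) ^ (-β) / η + 2 * (a * δ ^ (-g)) * η)
    {ι : Type*} [Fintype ι] {c d : ι → ℝ} (hcd : ∀ i, c i ≤ d i)
    (hdis : Pairwise (Function.onFun Disjoint (fun i => Ico (c i) (d i)))) {X : Set ℝ}
    (hX : X =ᵐ[volume] ⋃ i, Ico (c i) (d i))
    {δ : ℝ} (hδ : 0 < δ) (ω : Om m) {N : ℕ} (hN : 2 ≤ N) {A : Set ℝ} (hA : MeasurableSet A)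
    {η : ℝ} (hη : 0 < η) (hη1 : η ≤ 1) (hc : ∀ i, δ + η ≤ c i) :
    |covS (ν ω) ((randComp (fun i => lsv (γ i)) ω N) ⁻¹' A) X| ≤
      2 * Fintype.card ι * (K * (N:ℝ) ^ (-β) / η + 2 * (a * δ ^ (-g)) * η) := by
  haveI := S.prob ω
  have hac : ν ω ≪ volume := by
    rw [S.dens ω]
    exact (withDensity_absolutelyContinuous _ _).trans Measure.absolutelyContinuous_restrict
  have hQm := measurable_randComp γ ω N hA
  rw [covS_congr _ _ (hac.ae_eq hX), covS_union _ hQm (fun i => measurableSet_Ico) hdis]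
  refine (Finset.abs_sum_le_sum_abs _ _).trans ?_
  have : ∀ i ∈ Finset.univ,
      |covS (ν ω) ((randComp (fun i => lsv (γ i)) ω N) ⁻¹' A) (Ico (c i) (d i))| ≤
      2 * (K * (N:ℝ) ^ (-β) / η + 2 * (a * δ ^ (-g)) * η) := by
    intro i _
    have e : Ico (c i) (d i) = Iio (d i) \ Iio (c i) := by
      ext x; simp [and_comm]
    rw [e, covS_diff _ _ measurableSet_Iio hQm (Iio_subset_Iio (hcd i))]
    have h1 := hK δ hδ ω N hN A hA (c i) η hη hη1 (hc i)
    have h2 := hK δ hδ ω N hN A hA (d i) η hη hη1 ((hc i).trans (hcd i))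
    exact (abs_sub _ _).trans (by linarith)
  refine (Finset.sum_le_sum this).trans ?_
  rw [Finset.sum_const, Finset.card_univ, nsmul_eq_mul]
  exact le_of_eq (by ring)

end decor


section recur
variable {m : ℕ}
variable {γ : Fin m → ℝ} {ν : Om m → Measure ℝ} {h : Om m → ℝ → ℝ} {g a C : ℝ}

lemma measurableSet_surv (γ : Fin m → ℝ) (ω : Om m) {A : Set ℝ} (hA : MeasurableSet A) (M : ℕ) :
    MeasurableSet (survSet (fun i => lsv (γ i)) ω A M) := by
  have : survSet (fun i => lsv (γ i)) ω A M =
      ⋂ k : ℕ, ⋂ _ : 1 ≤ k, ⋂ _ : k ≤ M, (randComp (fun i => lsv (γ i)) ω k ⁻¹' A)ᶜ := by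
    ext x; simp [survSet]
  rw [this]
  exact MeasurableSet.iInter fun k => MeasurableSet.iInter fun _ => MeasurableSet.iInter fun _ =>
    (measurable_randComp γ ω k hA).compl

/-- short returns -/
def shortR (γ : Fin m → ℝ) (ν : Om m → Measure ℝ) (A : Set ℝ) (gp : ℕ) (ω : Om m) : ℝ :=
  ∑ k ∈ Finset.range gp, (ν ω).real (A ∩ randComp (fun i => lsv (γ i)) ω (k + 1) ⁻¹' A)

lemma surv_zero (T : Fin m → ℝ → ℝ) (ω : Om m) (A : Set ℝ) : survSet T ω A 0 = univ := by
  ext x; simp only [survSet, mem_setOf_eq, mem_univ, iff_true]; intro k h1 h2; omega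

lemma surv_succ (T : Fin m → ℝ → ℝ) (ω : Om m) (A : Set ℝ) (M : ℕ) :
    survSet T ω A (M + 1) =
      randComp T ω 1 ⁻¹' (survSet T (shift ω) A M \ (A ∩ survSet T (shift ω) A M)) := by
  ext x
  simp only [survSet, mem_setOf_eq, mem_preimage, mem_diff, mem_inter_iff]
  have hadd : ∀ k, randComp T ω (1 + k) x = randComp T (shift ω) k (randComp T ω 1 x) :=
    fun k => randComp_add T ω 1 k x
  constructor
  · intro H
    refine ⟨fun k h1 h2 => ?_, fun hh => H 1 le_rfl (by omega) hh.1⟩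
    rw [← hadd]; exact H (1 + k) (by omega) (by omega)
  · rintro ⟨H1, H2⟩ k h1 h2
    obtain ⟨k, rfl⟩ := Nat.exists_eq_add_of_le h1
    rw [hadd]
    rcases Nat.eq_zero_or_pos k with rfl | hk
    · exact fun hh => H2 ⟨hh, H1⟩
    · exact H1 k hk (by omega)

lemma QSetup.step (S : QSetup γ ν h g a C) {A : Set ℝ} (hA : MeasurableSet A) {gp : ℕ}
    {e abar : ℝ} (hab : ∀ ω, (ν ω).real A ≤ abar)
    (hcov : ∀ ω B, MeasurableSet B →
      |covS (ν ω) (randComp (fun i => lsv (γ i)) ω gp ⁻¹' B) A| ≤ e) (ω : Om m) (M : ℕ) :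
    |(ν ω).real (survSet (fun i => lsv (γ i)) ω A (M + 1)) -
      (1 - (ν (shift ω)).real A) *
        (ν (shift ω)).real (survSet (fun i => lsv (γ i)) (shift ω) A M)| ≤
      shortR γ ν A gp (shift ω) + e + gp * abar ^ 2 := by
  set T : Fin m → ℝ → ℝ := fun i => lsv (γ i) with hT
  haveI := S.prob ω
  have e0 : (ν ω).real (survSet T ω A (M + 1)) = (ν (shift ω)).real (survSet T (shift ω) A M) -
      (ν (shift ω)).real (A ∩ survSet T (shift ω) A M) := by
    haveI := S.prob (shift ω)
    have hm := S.map_iter ω 1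
    rw [Function.iterate_one] at hm
    rw [surv_succ, ← measureReal_diff inter_subset_right (hA.inter (measurableSet_surv γ _ hA M)),
      ← hm, map_measureReal_apply (measurable_randComp γ ω 1)
      ((measurableSet_surv γ _ hA M).diff (hA.inter (measurableSet_surv γ _ hA M)))]
  rw [e0]
  generalize shift ω = w
  haveI := S.prob w
  set V := survSet T w A M with hV
  set B := survSet T (shift^[gp] w) A (M - gp) with hB
  have hVm : MeasurableSet V := measurableSet_surv γ w hA M
  have hBm : MeasurableSet B := measurableSet_surv γ _ hA _
  set G := randComp T w gp ⁻¹' B with hG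
  have hGm : MeasurableSet G := measurable_randComp γ w gp hBm
  set E := ⋃ k ∈ Finset.range gp, randComp T w (k + 1) ⁻¹' A with hE
  have hVG : V ⊆ G := by
    intro x hx k h1 h2
    rw [← randComp_add]
    exact hx (gp + k) (by omega) (by omega)
  have hGV : G ⊆ V ∪ E := by
    intro x hx
    by_cases hxE : x ∈ E
    · exact Or.inr hxE
    left
    intro k h1 h2 hk
    rcases le_or_gt k gp with hkg | hkg
    · refine hxE ?_
      simp only [hE, mem_iUnion, mem_preimage, Finset.mem_range]
      refine ⟨k - 1, by omega, ?_⟩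
      rwa [Nat.sub_add_cancel h1]
    · refine hx (k - gp) (by omega) (by omega) ?_
      rw [← randComp_add, Nat.add_sub_cancel' hkg.le]
      exact hk
  -- three estimates
  have b1 : (ν w).real (A ∩ G) ≤ (ν w).real (A ∩ V) + shortR γ ν A gp w := by
    have : A ∩ G ⊆ (A ∩ V) ∪ ⋃ k ∈ Finset.range gp, (A ∩ randComp T w (k + 1) ⁻¹' A) := by
      rintro x ⟨hxA, hxG⟩
      rcases hGV hxG with hx | hx
      · exact Or.inl ⟨hxA, hx⟩
      · right
        simp only [hE, mem_iUnion] at hx ⊢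
        obtain ⟨k, hk, hx⟩ := hx
        exact ⟨k, hk, hxA, hx⟩
    refine (measureReal_mono this).trans ((measureReal_union_le _ _).trans ?_)
    gcongr
    exact measureReal_biUnion_finset_le _ _
  have b1' : (ν w).real (A ∩ V) ≤ (ν w).real (A ∩ G) :=
    measureReal_mono (inter_subset_inter_right _ hVG)
  have b2 : (ν w).real G ≤ (ν w).real V + gp * abar := by
    refine (measureReal_mono hGV).trans ((measureReal_union_le _ _).trans ?_)
    gcongr
    refine (measureReal_biUnion_finset_le _ _).trans ?_
    have : ∀ k ∈ Finset.range gp, (ν w).real (randComp T w (k + 1) ⁻¹' A) ≤ abar := by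
      intro k _
      rw [← map_measureReal_apply (measurable_randComp γ w (k + 1)) hA, S.map_iter]
      exact hab _
    refine (Finset.sum_le_sum this).trans ?_
    rw [Finset.sum_const, Finset.card_range, nsmul_eq_mul]
  have b2' : (ν w).real V ≤ (ν w).real G := measureReal_mono hVG
  have b3 := hcov w B hBm
  rw [covS] at b3
  have a0 : 0 ≤ (ν w).real A := measureReal_nonneg
  have a1 := hab w
  have habar : 0 ≤ abar := a0.trans a1
  have b4 : (ν w).real A * (ν w).real G ≤ (ν w).real A * (ν w).real V + gp * abar ^ 2 := by
    calc _ ≤ (ν w).real A * ((ν w).real V + gp * abar) := by gcongr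
      _ = (ν w).real A * (ν w).real V + (ν w).real A * (gp * abar) := by ring
      _ ≤ (ν w).real A * (ν w).real V + abar * (gp * abar) := by gcongr
      _ = _ := by ring
  have b4' : (ν w).real A * (ν w).real V ≤ (ν w).real A * (ν w).real G := by gcongr
  have hs0 : 0 ≤ shortR γ ν A gp w := Finset.sum_nonneg fun _ _ => measureReal_nonneg
  have hg0 : 0 ≤ gp * abar ^ 2 := by positivity
  rw [abs_le] at *
  constructor <;> nlinarith

lemma QSetup.recursion (S : QSetup γ ν h g a C) {A : Set ℝ} (hA : MeasurableSet A) {gp : ℕ}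
    {e abar : ℝ} (hab : ∀ ω, (ν ω).real A ≤ abar)
    (hcov : ∀ ω B, MeasurableSet B →
      |covS (ν ω) (randComp (fun i => lsv (γ i)) ω gp ⁻¹' B) A| ≤ e) (M : ℕ) (ω : Om m) :
    |(ν ω).real (survSet (fun i => lsv (γ i)) ω A M) -
      ∏ j ∈ Finset.range M, (1 - (ν (shift^[j + 1] ω)).real A)| ≤
      ∑ j ∈ Finset.range M, shortR γ ν A gp (shift^[j + 1] ω) + M * (e + gp * abar ^ 2) := by
  induction M generalizing ω with
  | zero =>
    haveI := S.prob ω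
    simp [surv_zero]
  | succ M ih =>
    haveI := S.prob (shift ω)
    have h1 := S.step hA hab hcov ω M
    have h2 := ih (shift ω)
    simp only [← Function.iterate_succ_apply] at h2
    have a0 : 0 ≤ (ν (shift ω)).real A := measureReal_nonneg
    have a1 : (ν (shift ω)).real A ≤ 1 := measureReal_le_one
    rw [Finset.prod_range_succ', Finset.sum_range_succ']
    simp only [zero_add, Function.iterate_one]
    set X := (ν ω).real (survSet (fun i => lsv (γ i)) ω A (M + 1))
    set Y := (ν (shift ω)).real (survSet (fun i => lsv (γ i)) (shift ω) A M)
    set b := (ν (shift ω)).real A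
    set Pr := ∏ k ∈ Finset.range M, (1 - (ν (shift^[k + 1 + 1] ω)).real A)
    set Sm := ∑ j ∈ Finset.range M, shortR γ ν A gp (shift^[j + 1 + 1] ω)
    have h2' : |Y - Pr| ≤ Sm + M * (e + gp * abar ^ 2) := h2
    have e1 : X - Pr * (1 - b) = (X - (1 - b) * Y) + (1 - b) * (Y - Pr) := by ring
    rw [e1]
    refine (abs_add_le _ _).trans ?_
    have h3 : |(1 - b) * (Y - Pr)| ≤ |Y - Pr| := by
      rw [abs_mul, abs_of_nonneg (by linarith : 0 ≤ 1 - b)]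
      exact mul_le_of_le_one_left (abs_nonneg _) (by linarith)
    push_cast
    linarith

/-- total short returns are controlled by `Xsum` -/
lemma QSetup.shortR_sum (S : QSetup γ ν h g a C) {A : Set ℝ} (hA : MeasurableSet A) {δ θ x0 : ℝ}
    (hδ : 0 < δ) (hAδ : A ⊆ Ici δ) {r K n : ℕ} (hAr : ∀ x ∈ A, |x - x0| < (r:ℝ) / n)
    (ω : Om m) {n0 M : ℕ} (hM : n0 + M ≤ K * n) (hX : Xsum γ θ r K n x0 ω ≠ ∞) :
    ∑ j ∈ Finset.range M, shortR γ ν A ⌈(n:ℝ) ^ θ⌉₊ (shift^[j + 1] (shift^[n0] ω)) ≤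
      a * δ ^ (-g) * (Xsum γ θ r K n x0 ω).toReal := by
  set gp := ⌈(n:ℝ) ^ θ⌉₊ with hgp
  have ha := S.a0
  have hM0 : 0 < a * δ ^ (-g) := by positivity
  set f : ℕ → ℝ≥0∞ := fun i => ∑ k ∈ Finset.range gp,
    (ν (shift^[i] ω)) (A ∩ randComp (fun i => lsv (γ i)) (shift^[i] ω) (k + 1) ⁻¹' A) with hf
  have hfX : ∀ i, f i ≤ ENNReal.ofReal (a * δ ^ (-g)) *
      ∑ k ∈ Finset.range gp, mLeb (retSet γ (shift^[i] ω) (k + 1) ((r:ℝ) / n) x0) := by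
    intro i
    rw [Finset.mul_sum]
    refine Finset.sum_le_sum fun k _ => ?_
    refine (S.meas_le hδ _ (hA.inter (measurable_randComp γ _ (k + 1) hA))
      (inter_subset_left.trans hAδ)).trans ?_
    gcongr
    rintro x ⟨hx1, hx2⟩
    exact ⟨hAr x hx1, hAr _ hx2⟩
  have hsum : ∑ j ∈ Finset.range M, f (n0 + (j + 1)) ≤
      ENNReal.ofReal (a * δ ^ (-g)) * Xsum γ θ r K n x0 ω := by
    calc ∑ j ∈ Finset.range M, f (n0 + (j + 1))
        = ∑ i ∈ (Finset.range M).image (fun j => n0 + (j + 1)), f i := by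
          rw [Finset.sum_image]
          intro i _ j _ hij
          simp only at hij
          omega
      _ ≤ ∑ i ∈ Finset.range (K * n + 1), f i := by
          refine Finset.sum_le_sum_of_subset ?_
          intro i hi
          simp only [Finset.mem_image, Finset.mem_range] at hi ⊢
          omega
      _ ≤ _ := by
          rw [Xsum, Finset.mul_sum]
          exact Finset.sum_le_sum fun i _ => hfX i
  have hreal : ∀ j, shortR γ ν A gp (shift^[j + 1] (shift^[n0] ω)) = (f (n0 + (j + 1))).toReal := by
    intro j
    have e1 : shift^[j + 1] (shift^[n0] ω) = shift^[n0 + (j + 1)] ω := by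
      rw [← Function.iterate_add_apply, add_comm]
    rw [e1, hf, shortR, ENNReal.toReal_sum]
    · rfl
    · intro k _
      haveI := S.prob (shift^[n0 + (j + 1)] ω)
      exact measure_ne_top _ _
  simp_rw [hreal]
  have hfin : ∀ i, f i ≠ ∞ := by
    intro i
    haveI := S.prob (shift^[i] ω)
    exact ENNReal.sum_ne_top.2 fun k _ => measure_ne_top _ _
  rw [← ENNReal.toReal_sum (fun i _ => hfin _)]
  refine (ENNReal.toReal_mono (ENNReal.mul_ne_top ENNReal.ofReal_ne_top hX) hsum).trans ?_
  rw [ENNReal.toReal_mul, ENNReal.toReal_ofReal hM0.le]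

/-- product limit -/
lemma prod_tendsto {b : ℕ → ℕ → ℝ} {M : ℕ → ℕ} {c lam : ℝ} (hb0 : ∀ n j, 0 ≤ b n j)
    (hbc : ∀ᶠ n : ℕ in atTop, ∀ j, b n j ≤ c / n)
    (hsum : Tendsto (fun n => ∑ j ∈ Finset.range (M n), b n j) atTop (𝓝 lam)) :
    Tendsto (fun n => ∏ j ∈ Finset.range (M n), (1 - b n j)) atTop (𝓝 (Real.exp (-lam))) := by
  have hc0 : Tendsto (fun n : ℕ => c / n) atTop (𝓝 0) := tendsto_const_div_atTop_nhds_zero_nat c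
  have hhalf : ∀ᶠ n : ℕ in atTop, c / n ≤ 1 / 2 := hc0.eventually (ge_mem_nhds (by norm_num))
  have hup : Tendsto (fun n => Real.exp (-∑ j ∈ Finset.range (M n), b n j)) atTop
      (𝓝 (Real.exp (-lam))) := (Real.continuous_exp.tendsto _).comp hsum.neg
  have hlow : Tendsto (fun n => Real.exp (-((1 + c / n) * ∑ j ∈ Finset.range (M n), b n j))) atTop
      (𝓝 (Real.exp (-lam))) := by
    refine (Real.continuous_exp.tendsto _).comp ?_
    have := ((tendsto_const_nhds (x := (1:ℝ))).add hc0).mul hsum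
    simpa using this.neg
  refine tendsto_of_tendsto_of_tendsto_of_le_of_le' hlow hup ?_ ?_
  · filter_upwards [hbc, hhalf] with n h1 h2
    rw [Finset.mul_sum, ← Finset.sum_neg_distrib, Real.exp_sum]
    refine Finset.prod_le_prod (fun j _ => (Real.exp_pos _).le) fun j _ => ?_
    have hbj := hb0 n j
    have hbj2 := h1 j
    have k1 : Real.exp (-((1 + c / n) * b n j)) ≤ Real.exp (-(b n j + b n j ^ 2)) := by
      apply Real.exp_le_exp.2; nlinarith
    refine k1.trans ?_
    -- exp(-(x+x^2)) ≤ 1 - x for 0 ≤ x ≤ 1/2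
    set x := b n j
    have hx : x ≤ 1 / 2 := hbj2.trans h2
    rw [Real.exp_neg, inv_le_comm₀ (Real.exp_pos _) (by linarith)]
    have k2 := Real.quadratic_le_exp_of_nonneg (show 0 ≤ x + x ^ 2 by positivity)
    refine le_trans ?_ k2
    rw [inv_le_iff_one_le_mul₀ (by linarith)]
    nlinarith [mul_nonneg hbj hbj, mul_nonneg (mul_nonneg hbj hbj) (sub_nonneg.2 hx), mul_nonneg (mul_nonneg (mul_nonneg hbj hbj) hbj) (sub_nonneg.2 hx)]
  · filter_upwards [hbc, hhalf] with n h1 h2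
    rw [← Finset.sum_neg_distrib, Real.exp_sum]
    refine Finset.prod_le_prod (fun j _ => by linarith [h1 j]) fun j _ => ?_
    have := Real.add_one_le_exp (-(b n j))
    linarith

end recur


section core
variable {m : ℕ}
variable {γ : Fin m → ℝ} {ν : Om m → Measure ℝ} {h : Om m → ℝ → ℝ} {g a C : ℝ}

lemma floor_div (s : ℝ) (hs : 0 ≤ s) :
    Tendsto (fun n : ℕ => ((⌊(n:ℝ) * s⌋₊ : ℕ) : ℝ) / n) atTop (𝓝 s) := by
  have := (tendsto_nat_floor_mul_div_atTop (R := ℝ) hs).comp tendsto_natCast_atTop_atTop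
  refine this.congr fun n => ?_
  simp [mul_comm]

lemma avg_sub {H : ℕ → ℝ} {I : ℝ}
    (hH : Tendsto (fun M : ℕ => (∑ k ∈ Finset.range M, H k) / M) atTop (𝓝 I))
    {N : ℕ → ℕ} {τ : ℝ} (hτ : 0 ≤ τ) (hN : Tendsto (fun n : ℕ => (N n : ℝ) / n) atTop (𝓝 τ)) :
    Tendsto (fun n : ℕ => (∑ k ∈ Finset.range (N n), H k) / n) atTop (𝓝 (τ * I)) := by
  set D : ℕ → ℝ := fun M => (∑ k ∈ Finset.range M, H k) / M - I with hD
  have hD0 : Tendsto D atTop (𝓝 0) := by simpa using hH.sub_const I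
  have key : Tendsto (fun n : ℕ => (N n : ℝ) / n * D (N n)) atTop (𝓝 0) := by
    rcases hτ.eq_or_lt with h0 | h0
    · subst h0
      obtain ⟨B, hB⟩ := hD0.abs.bddAbove_range
      refine squeeze_zero_norm (a := fun n : ℕ => (N n : ℝ) / n * B) (fun n => ?_) ?_
      · rw [norm_mul, Real.norm_of_nonneg (by positivity)]
        gcongr
        exact hB ⟨N n, rfl⟩
      · simpa using hN.mul_const B
    · have hNinf : Tendsto N atTop atTop := by
        rw [← tendsto_natCast_atTop_iff (R := ℝ)]
        have := hN.pos_mul_atTop h0 (tendsto_natCast_atTop_atTop (R := ℝ))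
        refine this.congr' ?_
        filter_upwards [eventually_gt_atTop 0] with n hn
        have : (n:ℝ) ≠ 0 := by positivity
        field_simp
      simpa using hN.mul (hD0.comp hNinf)
  have := key.add (hN.mul_const I)
  rw [zero_add] at this
  refine this.congr fun n => ?_
  simp only [hD]
  rcases Nat.eq_zero_or_pos (N n) with hz | hz
  · simp [hz]
  · have : (N n : ℝ) ≠ 0 := by positivity
    field_simp
    ring

lemma floor_sum_div {H : ℕ → ℝ} {I : ℝ}
    (hH : Tendsto (fun M : ℕ => (∑ k ∈ Finset.range M, H k) / M) atTop (𝓝 I))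
    {s t : ℝ} (hs : 0 ≤ s) (hst : s < t) :
    Tendsto (fun n : ℕ => (∑ j ∈ Finset.range ⌊(n:ℝ) * (t - s)⌋₊,
      H (⌊(n:ℝ) * s⌋₊ + (j + 1))) / n) atTop (𝓝 ((t - s) * I)) := by
  have h1 := floor_div s hs
  have h2 := floor_div (t - s) (by linarith)
  have hone : Tendsto (fun n : ℕ => (1:ℝ) / n) atTop (𝓝 0) := tendsto_const_div_atTop_nhds_zero_nat 1
  have c1 := avg_sub hH (N := fun n => ⌊(n:ℝ) * s⌋₊ + 1) hs (by
    have := h1.add hone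
    rw [add_zero] at this
    refine this.congr fun n => ?_
    push_cast; ring)
  have c2 := avg_sub hH (N := fun n => ⌊(n:ℝ) * s⌋₊ + 1 + ⌊(n:ℝ) * (t - s)⌋₊) (τ := t) (by linarith) (by
    have := (h1.add hone).add h2
    rw [add_zero, add_sub_cancel] at this
    refine this.congr fun n => ?_
    push_cast; ring)
  have := c2.sub c1
  rw [← sub_mul] at this
  refine this.congr fun n => ?_
  rw [Finset.sum_range_add, ← sub_div, add_sub_cancel_left]
  congr 1
  refine Finset.sum_congr rfl fun j _ => ?_
  congr 1
  ring

/-- exponents -/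
lemma exps {β : ℝ} (hβ : 2 < β) : ∃ θ κ : ℝ, 0 < θ ∧ θ < 1 ∧ 0 < κ ∧ θ * β = 2 + 2 * κ := by
  refine ⟨(2 / β + 1) / 2, (β / 2 - 1) / 2, by positivity, ?_, by linarith, ?_⟩
  · have : 2 / β < 1 := by rw [div_lt_one (by linarith)]; exact hβ
    linarith
  · field_simp; ring

lemma QSetup.core (S : QSetup γ ν h g a C) {K β : ℝ} (hK0 : 0 < K) (hβ : 2 < β)
    (hK : ∀ (δ : ℝ), 0 < δ → ∀ (ω : Om m) (N : ℕ), 2 ≤ N → ∀ A : Set ℝ, MeasurableSet A →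
    ∀ c η : ℝ, 0 < η → η ≤ 1 → δ + η ≤ c →
    |covS (ν ω) ((randComp (fun i => lsv (γ i)) ω N) ⁻¹' A) (Iio c)| ≤
      K * (N:ℝ) ^ (-β) / η + 2 * (a * δ ^ (-g)) * η)
    {θ κ : ℝ} (hθ : 0 < θ) (hθ1 : θ < 1) (hκ : 0 < κ) (hθβ : θ * β = 2 + 2 * κ)
    {x0 : ℝ} (hx0 : x0 ∈ Ioo (0:ℝ) 1)
    {ι : Type*} [Fintype ι] {lo hi : ι → ℝ} (hlh : ∀ i, lo i ≤ hi i)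
    (hdis : Pairwise (Function.onFun Disjoint (fun i => Ico (lo i) (hi i)))) {r : ℕ}
    (hlo : ∀ i, -(r:ℝ) ≤ lo i) 
    {A : ℕ → Set ℝ} (hA : ∀ n, MeasurableSet (A n))
    (hAr : ∀ n, 0 < n → ∀ x ∈ A n, |x - x0| < (r:ℝ) / n)
    (hAe : ∀ n, 0 < n → A n =ᵐ[volume] ⋃ i, Ico (x0 + lo i / n) (x0 + hi i / n))
    {ω : Om m} {I : ℝ} (hX : ∀ k : ℕ, Tendsto (fun n => Xsum γ θ r k n x0 ω) atTop (𝓝 0))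
    (hB : Tendsto (fun M : ℕ => (∑ k ∈ Finset.range M, h (shift^[k] ω) x0) / M) atTop (𝓝 I))
    {s t : ℝ} (hs : 0 ≤ s) (hst : s < t) :
    Tendsto (fun n : ℕ => (ν (shift^[⌊(n : ℝ) * s⌋₊] ω)).real
        (survSet (fun i => lsv (γ i)) (shift^[⌊(n : ℝ) * s⌋₊] ω) (A n) ⌊(n : ℝ) * (t - s)⌋₊))
      atTop (𝓝 (Real.exp (-((t - s) * I * ∑ i, (hi i - lo i))))) := by
  set W := ∑ i, (hi i - lo i) with hW
  have hW0 : 0 ≤ W := Finset.sum_nonneg fun i _ => sub_nonneg.2 (hlh i)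
  have hx0p := hx0.1
  have ha := S.a0
  set L := LipC a g (x0 / 2) with hL
  have hL0 : 0 < L := S.lipC_pos (by linarith)
  set Mx := a * x0 ^ (-g) with hMx
  have hMx0 : 0 < Mx := by positivity
  set c := (Mx + L * r) * W with hc
  have hc0 : 0 ≤ c := by positivity
  set Mδ := a * (x0 / 4) ^ (-g) with hMδ
  have hMδ0 : 0 < Mδ := by positivity
  -- scaled disjointness
  have hdis' : ∀ n : ℕ, 0 < n → Pairwise (Function.onFun Disjoint
      (fun i => Ico (x0 + lo i / n) (x0 + hi i / n))) := by
    intro n hn i j hij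
    have hn' : (0:ℝ) < n := by exact_mod_cast hn
    rw [Function.onFun, Set.disjoint_left]
    rintro y ⟨h1, h2⟩ ⟨h3, h4⟩
    have hdd : Disjoint (Ico (lo i) (hi i)) (Ico (lo j) (hi j)) := hdis hij
    refine Set.disjoint_left.1 hdd (show (y - x0) * (n:ℝ) ∈ Ico (lo i) (hi i) from ⟨?_, ?_⟩) ⟨?_, ?_⟩
    · rw [← div_le_iff₀ hn']; linarith
    · rw [← lt_div_iff₀ hn']; linarith
    · rw [← div_le_iff₀ hn']; linarith
    · rw [← lt_div_iff₀ hn']; linarith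
  have hvol : ∀ n : ℕ, 0 < n → volume.real (A n) = W / n := by
    intro n hn
    have hn' : (0:ℝ) < n := by exact_mod_cast hn
    rw [measureReal_congr (hAe n hn), measureReal_iUnion_fintype (hdis' n hn)
      (fun i => measurableSet_Ico) (fun i => measure_Ico_lt_top.ne), hW, Finset.sum_div]
    refine Finset.sum_congr rfl fun i _ => ?_
    have := div_le_div_of_nonneg_right (hlh i) hn'.le
    rw [Real.volume_real_Ico_of_le (by linarith)]
    ring
  -- small scale
  have hsmall : ∀ᶠ n : ℕ in atTop, 0 < n ∧ (r:ℝ) / n ≤ x0 / 4 ∧ (r:ℝ) / n ≤ 1 - x0 := by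
    have h0 : Tendsto (fun n : ℕ => (r:ℝ) / n) atTop (𝓝 0) := tendsto_const_div_atTop_nhds_zero_nat _
    exact (eventually_gt_atTop 0).and ((h0.eventually (ge_mem_nhds (by linarith))).and
      (h0.eventually (ge_mem_nhds (by linarith [hx0.2]))))
  -- measure of A
  have hmeas : ∀ᶠ n : ℕ in atTop, ∀ w : Om m,
      |(ν w).real (A n) - h w x0 * (W / n)| ≤ L * (r / n) * (W / n) := by
    filter_upwards [hsmall] with n ⟨hn, h1, h2⟩ w
    have := S.meas_near hx0.1 (ρ := (r:ℝ) / n) (by positivity) (by linarith) h2 w (hA n)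
      (fun x hx => by
        have := hAr n hn x hx
        rw [abs_lt] at this
        constructor <;> linarith)
    rwa [hvol n hn] at this
  have habar : ∀ᶠ n : ℕ in atTop, ∀ w : Om m, (ν w).real (A n) ≤ c / n := by
    filter_upwards [hmeas, hsmall] with n h1 ⟨hn, _, _⟩ w
    have hn' : (1:ℝ) ≤ n := by exact_mod_cast hn
    have h2 := (abs_le.1 (h1 w)).2
    have h3 := (abs_le.1 (S.abs_h_le hx0 w)).2
    have h4 : L * ((r:ℝ) / n) ≤ L * r := by
      gcongr; exact div_le_self (by positivity) hn'
    have h5 : 0 ≤ W / n := by positivity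
    calc (ν w).real (A n) ≤ h w x0 * (W / n) + L * (r / n) * (W / n) := by linarith
      _ ≤ Mx * (W / n) + L * r * (W / n) := by gcongr
      _ = c / n := by rw [hc]; ring
  -- gap and decorrelation
  set gp : ℕ → ℕ := fun n => ⌈(n:ℝ) ^ θ⌉₊ with hgp
  set e : ℕ → ℝ := fun n => 2 * Fintype.card ι * ((K + 2 * Mδ) * (n:ℝ) ^ (-1 - κ)) with he
  have hη_lim : Tendsto (fun n : ℕ => (n:ℝ) ^ (-1 - κ)) atTop (𝓝 0) := by
    have := (tendsto_rpow_neg_atTop (by linarith : 0 < 1 + κ)).comp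
      (tendsto_natCast_atTop_atTop (R := ℝ))
    refine this.congr fun n => ?_
    simp only [Function.comp]
    congr 1; ring
  have hgp_inf : Tendsto (fun n : ℕ => (n:ℝ) ^ θ) atTop atTop :=
    (tendsto_rpow_atTop hθ).comp tendsto_natCast_atTop_atTop
  have hcov : ∀ᶠ n : ℕ in atTop, ∀ w B, MeasurableSet B →
      |covS (ν w) (randComp (fun i => lsv (γ i)) w (gp n) ⁻¹' B) (A n)| ≤ e n := by
    filter_upwards [hsmall, hη_lim.eventually (ge_mem_nhds (show (0:ℝ) < 1 by norm_num)),
      hη_lim.eventually (ge_mem_nhds (show (0:ℝ) < x0 / 4 by linarith)),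
      hgp_inf.eventually (eventually_ge_atTop 2)] with n ⟨hn, h1, h2⟩ h3 h4 h5 w B hBm
    have hn' : (0:ℝ) < n := by exact_mod_cast hn
    have hgp2 : 2 ≤ gp n := by
      have : (2:ℝ) ≤ gp n := h5.trans (Nat.le_ceil _)
      exact_mod_cast this
    have hη0 : 0 < (n:ℝ) ^ (-1 - κ) := by positivity
    have := S.cov_union_bound hK (c := fun i => x0 + lo i / n) (d := fun i => x0 + hi i / n)
      (fun i => by have := div_le_div_of_nonneg_right (hlh i) hn'.le; linarith) (hdis' n hn)
      (hAe n hn) (δ := x0 / 4) (by linarith) w hgp2 hBm hη0 h3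
      (fun i => by
        have := div_le_div_of_nonneg_right (hlo i) hn'.le
        rw [neg_div] at this
        linarith)
    refine this.trans ?_
    rw [he]
    refine mul_le_mul_of_nonneg_left ?_ (by positivity)
    rw [add_mul]
    refine add_le_add ?_ le_rfl
    have hg1 : ((gp n : ℕ) : ℝ) ^ (-β) ≤ (n:ℝ) ^ (-(2 + 2 * κ)) := by
      rw [← hθβ, ← mul_neg, Real.rpow_mul hn'.le]
      exact Real.rpow_le_rpow_of_nonpos (by positivity) (Nat.le_ceil _) (by linarith)
    rw [div_le_iff₀ hη0, mul_assoc, ← Real.rpow_add hn']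
    refine (mul_le_mul_of_nonneg_left hg1 hK0.le).trans (le_of_eq ?_)
    congr 2; ring
  set n0 : ℕ → ℕ := fun n => ⌊(n:ℝ) * s⌋₊ with hn0
  set Mn : ℕ → ℕ := fun n => ⌊(n:ℝ) * (t - s)⌋₊ with hMn
  have hn0le : ∀ n, (n0 n : ℝ) ≤ n * s := fun n => Nat.floor_le (by positivity)
  have hMnle : ∀ n, (Mn n : ℝ) ≤ n * (t - s) := fun n =>
    Nat.floor_le (mul_nonneg (by positivity) (by linarith))
  -- products
  have hprod : Tendsto (fun n => ∏ j ∈ Finset.range (Mn n),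
      (1 - (ν (shift^[j + 1] (shift^[n0 n] ω))).real (A n))) atTop
      (𝓝 (Real.exp (-((t - s) * I * W)))) := by
    refine prod_tendsto (c := c) (fun n j => measureReal_nonneg) ?_ ?_
    · filter_upwards [habar] with n hn j using hn _
    have h1 := (floor_sum_div hB hs hst).mul_const W
    have h2 : Tendsto (fun n : ℕ => L * r * W * (t - s) / (n:ℝ)) atTop (𝓝 0) :=
      tendsto_const_div_atTop_nhds_zero_nat _
    have h3 : Tendsto (fun n : ℕ => ∑ j ∈ Finset.range (Mn n),
        (ν (shift^[j + 1] (shift^[n0 n] ω))).real (A n) -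
        (∑ j ∈ Finset.range (Mn n), h (shift^[n0 n + (j + 1)] ω) x0) / n * W) atTop (𝓝 0) := by
      refine squeeze_zero_norm' ?_ h2
      filter_upwards [hmeas, hsmall] with n hn ⟨hn1, _, _⟩
      have hn' : (0:ℝ) < n := by exact_mod_cast hn1
      rw [Finset.sum_div, Finset.sum_mul, ← Finset.sum_sub_distrib, Real.norm_eq_abs]
      refine (Finset.abs_sum_le_sum_abs _ _).trans ?_
      have : ∀ j ∈ Finset.range (Mn n), |(ν (shift^[j + 1] (shift^[n0 n] ω))).real (A n) -
          h (shift^[n0 n + (j + 1)] ω) x0 / n * W| ≤ L * (r / n) * (W / n) := by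
        intro j _
        have e1 : shift^[j + 1] (shift^[n0 n] ω) = shift^[n0 n + (j + 1)] ω := by
          rw [← Function.iterate_add_apply, add_comm]
        rw [e1]
        have := hn (shift^[n0 n + (j + 1)] ω)
        rwa [div_mul_eq_mul_div, mul_div_assoc]
      refine (Finset.sum_le_sum this).trans ?_
      rw [Finset.sum_const, Finset.card_range, nsmul_eq_mul]
      calc (Mn n : ℝ) * (L * (r / n) * (W / n)) ≤ (n * (t - s)) * (L * (r / n) * (W / n)) := by
            gcongr; exact hMnle n
        _ = _ := by field_simp
    have := h3.add h1
    rw [zero_add] at this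
    refine this.congr fun n => ?_
    simp only [hn0, hMn]
    ring
  -- error
  set k0 : ℕ := ⌈t⌉₊ with hk0
  have herr : Tendsto (fun n : ℕ => Mδ * (Xsum γ θ r k0 n x0 ω).toReal +
      (n * (t - s)) * (e n + ((n:ℝ) ^ θ + 1) * (c / n) ^ 2)) atTop (𝓝 0) := by
    have t1 : Tendsto (fun n : ℕ => Mδ * (Xsum γ θ r k0 n x0 ω).toReal) atTop (𝓝 0) := by
      have := ((ENNReal.tendsto_toReal ENNReal.zero_ne_top).comp (hX k0)).const_mul Mδ
      simpa using this
    have t2 : Tendsto (fun n : ℕ => (n:ℝ) ^ (-κ)) atTop (𝓝 0) :=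
      (tendsto_rpow_neg_atTop hκ).comp (tendsto_natCast_atTop_atTop (R := ℝ))
    have t3 : Tendsto (fun n : ℕ => (n:ℝ) ^ (-(1 - θ))) atTop (𝓝 0) :=
      (tendsto_rpow_neg_atTop (by linarith)).comp (tendsto_natCast_atTop_atTop (R := ℝ))
    have t4 : Tendsto (fun n : ℕ => (1:ℝ) / n) atTop (𝓝 0) := tendsto_const_div_atTop_nhds_zero_nat 1
    have := t1.add (((t2.const_mul (2 * Fintype.card ι * (K + 2 * Mδ))).add
      ((t3.add t4).mul_const (c ^ 2))).const_mul (t - s))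
    simp only [mul_zero, zero_mul, add_zero] at this
    refine this.congr' ?_
    filter_upwards [eventually_gt_atTop 0] with n hn
    have hn' : (0:ℝ) < n := by exact_mod_cast hn
    have e1 : (n:ℝ) ^ (-1 - κ) = (n:ℝ) ^ (-κ) / n := by
      rw [sub_eq_add_neg, Real.rpow_add hn', Real.rpow_neg_one]; ring
    have e2 : (n:ℝ) ^ (-(1 - θ)) = (n:ℝ) ^ θ / n := by
      rw [neg_sub, Real.rpow_sub hn', Real.rpow_one]
    simp only [he]
    rw [e1, e2]
    field_simp
  have hdiff : Tendsto (fun n : ℕ => (ν (shift^[n0 n] ω)).real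
        (survSet (fun i => lsv (γ i)) (shift^[n0 n] ω) (A n) (Mn n)) -
      ∏ j ∈ Finset.range (Mn n),
      (1 - (ν (shift^[j + 1] (shift^[n0 n] ω))).real (A n))) atTop (𝓝 0) := by
    refine squeeze_zero_norm' ?_ herr
    filter_upwards [hsmall, habar, hcov, (hX k0).eventually (gt_mem_nhds ENNReal.zero_lt_top)] with
      n ⟨hn, h1, h2⟩ h3 h4 h5
    have hn' : (0:ℝ) < n := by exact_mod_cast hn
    rw [Real.norm_eq_abs]
    refine (S.recursion (hA n) h3 h4 (Mn n) (shift^[n0 n] ω)).trans (add_le_add ?_ ?_)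
    · refine S.shortR_sum (hA n) (δ := x0 / 4) (by linarith) ?_ (hAr n hn) ω ?_ h5.ne
      · intro x hx
        have := hAr n hn x hx
        rw [abs_lt] at this
        simp only [mem_Ici]; linarith
      · have : ((n0 n + Mn n : ℕ) : ℝ) ≤ ((k0 * n : ℕ) : ℝ) := by
          push_cast
          have k1 := hn0le n
          have k2 := hMnle n
          have k3 : t ≤ k0 := Nat.le_ceil t
          nlinarith
        exact_mod_cast this
    · have hen : 0 ≤ e n := by simp only [he]; positivity
      have hgpn : (gp n : ℝ) ≤ (n:ℝ) ^ θ + 1 := (Nat.ceil_lt_add_one (by positivity)).le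
      have := hMnle n
      have : 0 ≤ t - s := by linarith
      gcongr
  have := hdiff.add hprod
  rw [zero_add] at this
  refine this.congr fun n => ?_
  simp only [hn0, hMn]
  ring

end core


section final
variable {m : ℕ}

lemma memJ_piece {α u y : ℝ} {v : ℝ≥0∞} (hα : 0 < α) (hu : 0 < u) (huv : ENNReal.ofReal u < v)
    (hy : 0 < y) :
    (u < y ∧ ENNReal.ofReal y ≤ v) ↔ (v.toReal ^ (-α) ≤ y ^ (-α) ∧ y ^ (-α) < u ^ (-α)) := by
  have h1 : u < y ↔ y ^ (-α) < u ^ (-α) := by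
    rw [Real.rpow_lt_rpow_iff_of_neg hy hu (by linarith)]
  have h2 : ENNReal.ofReal y ≤ v ↔ v.toReal ^ (-α) ≤ y ^ (-α) := by
    rcases eq_or_ne v ∞ with rfl | hv
    · simp only [le_top, ENNReal.toReal_top, true_iff]
      rw [Real.zero_rpow (by linarith)]
      positivity
    · have hv0 : 0 < v.toReal := ENNReal.toReal_pos (by
        rintro rfl; exact _root_.not_lt_zero huv) hv
      rw [ENNReal.ofReal_le_iff_le_toReal hv, Real.rpow_le_rpow_iff_of_neg hv0 hy (by linarith)]
  rw [h1, h2, and_comm]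

lemma lo_le_hi {α u : ℝ} {v : ℝ≥0∞} (hα : 0 < α) (hu : 0 < u) (huv : ENNReal.ofReal u < v) :
    v.toReal ^ (-α) ≤ u ^ (-α) := by
  rcases eq_or_ne v ∞ with rfl | hv
  · simp only [ENNReal.toReal_top]
    rw [Real.zero_rpow (by linarith)]
    positivity
  · have h1 : u < v.toReal := (ENNReal.ofReal_lt_iff_lt_toReal hu.le hv).1 huv
    exact Real.rpow_le_rpow_of_nonpos hu h1.le (by linarith)

lemma Aset_iff {α b x0 x : ℝ} {n : ℕ} {q : ℕ} {u : Fin q → ℝ} {v : Fin q → ℝ≥0∞} (hα : 0 < α)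
    (hb : 0 < b) (hn : 0 < n) (hu : ∀ i, 0 < u i) (huv : ∀ i, ENNReal.ofReal (u i) < v i) :
    x ∈ Aset α x0 ((b * (n:ℝ)) ^ α⁻¹) u v ↔
      x ≠ x0 ∧ ∃ i, ((v i).toReal ^ (-α) / b) / n ≤ |x - x0| ∧ |x - x0| < (u i ^ (-α) / b) / n := by
  have hn' : (0:ℝ) < n := by exact_mod_cast hn
  rcases eq_or_ne x x0 with rfl | hx
  · simp only [ne_eq, not_true_eq_false, false_and, iff_false]
    rintro ⟨i, h1, _⟩
    have : phiObs α x x = 0 := by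
      simp only [phiObs, sub_self, abs_zero]
      exact Real.zero_rpow (by simp [hα.ne'])
    rw [this, zero_div] at h1
    exact absurd h1 (not_lt.2 (hu i).le)
  · have hz : 0 < |x - x0| := abs_pos.2 (sub_ne_zero.2 hx)
    set z := |x - x0|
    set y := phiObs α x0 x / (b * (n:ℝ)) ^ α⁻¹ with hy
    have hφ : 0 < phiObs α x0 x := Real.rpow_pos_of_pos hz _
    have hy0 : 0 < y := by positivity
    have hyα : y ^ (-α) = z * (b * n) := by
      rw [hy, Real.div_rpow hφ.le (by positivity), phiObs, ← Real.rpow_mul (abs_nonneg _),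
        ← Real.rpow_mul (by positivity)]
      have e1 : -α⁻¹ * -α = 1 := by field_simp
      have e2 : α⁻¹ * -α = -1 := by field_simp
      rw [e1, e2, Real.rpow_one, Real.rpow_neg_one, div_inv_eq_mul]
    simp only [ne_eq, hx, not_false_eq_true, true_and]
    change (∃ i, u i < y ∧ ENNReal.ofReal y ≤ v i) ↔ _
    refine exists_congr fun i => ?_
    rw [memJ_piece hα (hu i) (huv i) hy0, hyα, div_div, div_div, div_le_iff₀ (by positivity),
      lt_div_iff₀ (by positivity)]

lemma disj_scale {α b : ℝ} {q : ℕ} {u : Fin q → ℝ} {v : Fin q → ℝ≥0∞} (hα : 0 < α)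
    (hb : 0 < b) (hu : ∀ i, 0 < u i) (huv : ∀ i, ENNReal.ofReal (u i) < v i)
    (hd : ∀ i j, i ≠ j → ∀ y : ℝ,
          ¬((u i < y ∧ ENNReal.ofReal y ≤ v i) ∧ (u j < y ∧ ENNReal.ofReal y ≤ v j)))
    {i j : Fin q} (hij : i ≠ j) {ρ : ℝ} (hρ : 0 < ρ) 
    (h1 : (v i).toReal ^ (-α) / b ≤ ρ) (h2 : ρ < u i ^ (-α) / b) 
    (h3 : (v j).toReal ^ (-α) / b ≤ ρ) (h4 : ρ < u j ^ (-α) / b) : False := by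
  have hρb : 0 < ρ * b := by positivity
  set y := (ρ * b) ^ (-α⁻¹) with hy
  have hy0 : 0 < y := by positivity
  have hyα : y ^ (-α) = ρ * b := by
    rw [hy, ← Real.rpow_mul hρb.le]
    have e1 : -α⁻¹ * -α = 1 := by field_simp
    rw [e1, Real.rpow_one]
  refine hd i j hij y ⟨(memJ_piece hα (hu i) (huv i) hy0).2 ?_, (memJ_piece hα (hu j) (huv j) hy0).2 ?_⟩
  · rw [hyα, ← div_le_iff₀ hb, ← lt_div_iff₀ hb]; exact ⟨h1, h2⟩
  · rw [hyα, ← div_le_iff₀ hb, ← lt_div_iff₀ hb]; exact ⟨h3, h4⟩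

lemma measurableSet_Aset (α x0 bn : ℝ) {q : ℕ} (u : Fin q → ℝ) (v : Fin q → ℝ≥0∞) :
    MeasurableSet (Aset α x0 bn u v) := by
  have hm : Measurable (fun x => phiObs α x0 x / bn) := by
    unfold phiObs
    refine Measurable.div_const ?_ _
    exact ((measurable_id.sub_const x0).abs).pow_const _
  have : Aset α x0 bn u v = ⋃ i, ({x | u i < phiObs α x0 x / bn} ∩
      {x | ENNReal.ofReal (phiObs α x0 x / bn) ≤ v i}) := by
    ext x; simp [Aset, memJ]
  rw [this]
  exact MeasurableSet.iUnion fun i => (measurableSet_lt measurable_const hm).inter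
    (measurableSet_le hm.ennreal_ofReal measurable_const)

/-- pieces (lower ends) -/
def pLo {q : ℕ} (l R : Fin q → ℝ) (k : Fin q × Bool) : ℝ := if k.2 then l k.1 else -R k.1
/-- pieces (upper ends) -/
def pHi {q : ℕ} (l R : Fin q → ℝ) (k : Fin q × Bool) : ℝ := if k.2 then R k.1 else -l k.1

lemma pieces_disj {q : ℕ} {l R : Fin q → ℝ} (hl : ∀ i, 0 ≤ l i)
    (hd : ∀ i j, i ≠ j → ∀ ρ, 0 < ρ → l i ≤ ρ → ρ < R i → l j ≤ ρ → ρ < R j → False) :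
    Pairwise (Function.onFun Disjoint (fun k => Ico (pLo l R k) (pHi l R k))) := by
  rintro ⟨i, bi⟩ ⟨j, bj⟩ hij
  rw [Function.onFun, Set.disjoint_left]
  rintro y ⟨h1, h2⟩ ⟨h3, h4⟩
  have hli := hl i
  have hlj := hl j
  cases bi <;> cases bj <;> simp only [pLo, pHi, if_true, if_false, Bool.false_eq_true] at h1 h2 h3 h4
  · have hne : i ≠ j := by rintro rfl; exact hij rfl
    refine hd i j hne ((max (l i) (l j) + -y) / 2) ?_ ?_ ?_ ?_ ?_
    all_goals
      have m1 := le_max_left (l i) (l j)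
      have m2 := le_max_right (l i) (l j)
      have m3 : max (l i) (l j) < -y := max_lt (by linarith) (by linarith)
      linarith
  · linarith
  · linarith
  · have hne : i ≠ j := by rintro rfl; exact hij rfl
    refine hd i j hne ((min (R i) (R j) + y) / 2) ?_ ?_ ?_ ?_ ?_
    all_goals
      have m1 := min_le_left (R i) (R j)
      have m2 := min_le_right (R i) (R j)
      have m3 : y < min (R i) (R j) := lt_min (by linarith) (by linarith)
      linarith

lemma pieces_ae {q : ℕ} {l R : Fin q → ℝ} (hl : ∀ i, 0 ≤ l i) {x0 n : ℝ} (hn : 0 < n)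
    {A : Set ℝ} (hA : ∀ x, x ∈ A ↔ x ≠ x0 ∧ ∃ i, l i / n ≤ |x - x0| ∧ |x - x0| < R i / n) :
    A =ᵐ[volume] ⋃ k : Fin q × Bool, Ico (x0 + pLo l R k / n) (x0 + pHi l R k / n) := by
  set F : Set ℝ := {x0} ∪ (Set.range fun i => x0 - R i / n) ∪ (Set.range fun i => x0 - l i / n)
  have hF : F.Finite := ((finite_singleton _).union (finite_range _)).union (finite_range _)
  have hF0 : ∀ᵐ x ∂(volume : Measure ℝ), x ∉ F := measure_eq_zero_iff_ae_notMem.1 (hF.measure_zero _)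
  rw [eventuallyEq_set]
  filter_upwards [hF0] with x hx
  have hx0 : x ≠ x0 := fun hh => hx (Or.inl (Or.inl hh))
  have hxR : ∀ i, x ≠ x0 - R i / n := fun i hh => hx (Or.inl (Or.inr ⟨i, hh.symm⟩))
  have hxl : ∀ i, x ≠ x0 - l i / n := fun i hh => hx (Or.inr ⟨i, hh.symm⟩)
  rw [hA, mem_iUnion]
  constructor
  · rintro ⟨_, i, h1, h2⟩
    rcases le_total 0 (x - x0) with h0 | h0
    · rw [abs_of_nonneg h0] at h1 h2
      refine ⟨(i, true), ?_, ?_⟩ <;> simp only [pLo, pHi, if_true] <;> linarith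
    · rw [abs_of_nonpos h0] at h1 h2
      refine ⟨(i, false), ?_, ?_⟩ <;>
        simp only [pLo, pHi, if_false, Bool.false_eq_true, neg_div]
      · linarith
      · exact lt_of_le_of_ne (by linarith) (by have := hxl i; rwa [← sub_eq_add_neg])
  · rintro ⟨⟨i, bi⟩, h1, h2⟩
    have hl' : 0 ≤ l i / n := div_nonneg (hl i) hn.le
    refine ⟨hx0, i, ?_⟩
    cases bi <;> simp only [pLo, pHi, if_true, if_false, Bool.false_eq_true, neg_div] at h1 h2
    · rw [abs_of_nonpos (by linarith)]
      refine ⟨by linarith, ?_⟩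
      have := lt_of_le_of_ne h1 (by have := (hxR i).symm; rwa [sub_eq_add_neg] at this)
      linarith
    · rw [abs_of_nonneg (by linarith)]
      constructor <;> linarith

lemma pieces_sum {q : ℕ} (l R : Fin q → ℝ) :
    ∑ k : Fin q × Bool, (pHi l R k - pLo l R k) = 2 * ∑ i, (R i - l i) := by
  rw [Fintype.sum_prod_type, Finset.mul_sum]
  refine Finset.sum_congr rfl fun i _ => ?_
  simp [pLo, pHi]
  ring

end final

theorem stmt13 (m : ℕ) (hm : 1 ≤ m)
    (γ : Fin m → ℝ) (hγ : ∀ i, γ i ∈ Set.Ioo (0 : ℝ) 1)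
    (gmax : ℝ) (hgmax1 : ∀ i, γ i ≤ gmax) (hgmax2 : ∃ i, γ i = gmax)
    (hgmax3 : gmax < 1 / 3)
    -- `P` is the Bernoulli product measure `(p_1, …, p_m)^{⊗ℤ}`
    (p : Fin m → ℝ) (hp : ∀ i, 0 < p i) (hp1 : ∑ i, p i = 1)
    (P : Measure (Om m)) (hPprob : IsProbabilityMeasure P)
    (hP : ∀ (s : Finset ℤ) (f : ℤ → Fin m),
      P {ω | ∀ i ∈ s, ω i = f i} = ENNReal.ofReal (∏ i ∈ s, p (f i)))
    -- the quenched measures `ν^ω` with densities `h_ω`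
    (ν : Om m → Measure ℝ) (hνprob : ∀ ω, IsProbabilityMeasure (ν ω))
    (h : Om m → ℝ → ℝ) (hmeas : ∀ ω, Measurable (h ω))
    (hdens : ∀ ω, ν ω = mLeb.withDensity (fun x => ENNReal.ofReal (h ω x)))
    -- (i): equivariance
    (hequiv : ∀ ω : Om m, (ν ω).map (lsv (γ (ω 0))) = ν (shift ω))
    -- (ii): the densities lie in the cone `L`
    (acone : ℝ) (hacone : 0 < acone)
    (hcone : ∀ ω, ContinuousOn (h ω) (Set.Ioc 0 1) ∧ (∀ x, 0 ≤ h ω x) ∧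
      AntitoneOn (h ω) (Set.Ioc 0 1) ∧
      MonotoneOn (fun x => x ^ (gmax + 1) * h ω x) (Set.Ioc 0 1) ∧
      ∀ x ∈ Set.Ioc (0 : ℝ) 1, h ω x ≤ acone * x ^ (-gmax))
    (C : ℝ) (hC : 0 < C)
    -- (iii): polynomial pullback approximation of `h_ω`
    (hpull : ∀ (ω : Om m) (n : ℕ), 2 ≤ n →
      tvDist (mLeb.map (randComp (fun i => lsv (γ i)) (shiftInv^[n] ω) n)) (ν ω) ≤
        C * (n : ℝ) ^ (1 - 1 / gmax) * (Real.log n) ^ (1 / gmax))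
    -- (iv): polynomial quenched decay of correlations for `C¹` observables
    (hdec : ∀ g : ℝ → ℝ, ContDiff ℝ 1 g → ∀ (ω : Om m) (N : ℕ), 2 ≤ N →
      (SignedMeasure.totalVariation
        (((ν ω).withDensityᵥ (fun x => g x - ∫ y, g y ∂(ν ω))).map
          (randComp (fun i => lsv (γ i)) ω N)) Set.univ).toReal ≤
        C * C1norm g * (N : ℝ) ^ (1 - 1 / gmax) * (Real.log N) ^ (1 / gmax))
    (α : ℝ) (hα : α ∈ Set.Ioo (0 : ℝ) 2)
    -- the annealed measure `ν(A) = ∫ ν^ω(A) d𝐏(ω)`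
    (νa : Measure ℝ)
    (hνa : ∀ A : Set ℝ, MeasurableSet A → νa A = ∫⁻ ω, ν ω A ∂P) :
    ∀ᵐ x0 ∂mLeb, ∃ b : ℝ, 0 < b ∧
      Tendsto (fun ε : ℝ => (νa {x | |x - x0| < ε}).toReal / ε) (𝓝[>] (0 : ℝ)) (𝓝 b) ∧
      ∀ (q : ℕ) (u : Fin q → ℝ) (v : Fin q → ℝ≥0∞), 1 ≤ q →
        (∀ i, 0 < u i) → (∀ i, ENNReal.ofReal (u i) < v i) →
        (∀ i j, i ≠ j → ∀ y : ℝ,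
          ¬((u i < y ∧ ENNReal.ofReal y ≤ v i) ∧ (u j < y ∧ ENNReal.ofReal y ≤ v j))) →
        ∀ᵐ ω ∂P, ∀ s t : ℝ, 0 ≤ s → s < t →
          Tendsto (fun n : ℕ =>
            ((ν (shift^[⌊(n : ℝ) * s⌋₊] ω))
              (survSet (fun i => lsv (γ i)) (shift^[⌊(n : ℝ) * s⌋₊] ω)
                (Aset α x0 ((b * (n : ℝ)) ^ α⁻¹) u v) ⌊(n : ℝ) * (t - s)⌋₊)).toReal)
            atTop (𝓝 (Real.exp (-(t - s) * PiAlpha α u v))) := by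
  have g0 : 0 < gmax := by
    obtain ⟨i, rfl⟩ := hgmax2; exact (hγ i).1
  have S : QSetup γ ν h gmax acone C :=
    { hγ := hγ, hg := hgmax1, g0 := g0, g3 := hgmax3, prob := hνprob, hmeas := hmeas, dens := hdens
      equiv := hequiv, a0 := hacone, nonneg := fun ω => (hcone ω).2.1
      anti := fun ω => (hcone ω).2.2.1, mono := fun ω => (hcone ω).2.2.2.1
      bdd := fun ω => (hcone ω).2.2.2.2, C0 := hC, pull := hpull, dec := hdec }
  obtain ⟨K, β, hK0, hβ, hK⟩ := S.cov_bound
  obtain ⟨θ, κ, hθ, hθ1, hκ, hθβ⟩ := exps hβ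
  have hIoo : ∀ᵐ x0 ∂mLeb, x0 ∈ Ioo (0:ℝ) 1 := by
    have e : mLeb = volume.restrict (Ioo (0:ℝ) 1) := by
      rw [mLeb]; exact (Measure.restrict_congr_set Ioo_ae_eq_Icc).symm
    rw [e]; exact ae_restrict_mem measurableSet_Ioo
  filter_upwards [hIoo, ae_Xsum hγ hgmax1 g0 hθ hθ1 P] with x0 hx0 hXs
  set I := ∫ ω, h ω x0 ∂P with hI
  have hI0 : 0 < I := S.integral_h_pos hx0 P
  refine ⟨2 * I, by positivity, S.annealed hx0 P νa hνa, fun q u v _ hu huv hd => ?_⟩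
  set b := 2 * I with hb
  have hb0 : 0 < b := by positivity
  set l : Fin q → ℝ := fun i => (v i).toReal ^ (-α) / b with hl
  set R : Fin q → ℝ := fun i => u i ^ (-α) / b with hR
  have hl0 : ∀ i, 0 ≤ l i := fun i => by simp only [hl]; positivity
  have hR0 : ∀ i, 0 < R i := fun i => by have := hu i; simp only [hR]; positivity
  have hlR : ∀ i, l i ≤ R i := fun i =>
    div_le_div_of_nonneg_right (lo_le_hi hα.1 (hu i) (huv i)) hb0.le
  set r : ℕ := ⌈∑ i, R i⌉₊ with hr
  have hRr : ∀ i, R i ≤ r := fun i =>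
    (Finset.single_le_sum (f := R) (fun j _ => (hR0 j).le) (Finset.mem_univ i)).trans (Nat.le_ceil _)
  filter_upwards [ae_all_iff.2 (fun k : ℕ => hXs r k), S.birkhoff_h hx0 hp hp1 P hP] with ω hX hB
    s t hs hst
  have hAiff : ∀ n : ℕ, 0 < n → ∀ x, x ∈ Aset α x0 ((b * (n : ℝ)) ^ α⁻¹) u v ↔
      x ≠ x0 ∧ ∃ i, l i / n ≤ |x - x0| ∧ |x - x0| < R i / n :=
    fun n hn x => Aset_iff hα.1 hb0 hn hu huv
  have := S.core hK0 hβ hK hθ hθ1 hκ hθβ hx0 (lo := pLo l R) (hi := pHi l R)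
    (by
      rintro ⟨i, bi⟩
      have := hlR i
      cases bi <;> simp only [pLo, pHi, if_true, if_false, Bool.false_eq_true] <;> linarith)
    (pieces_disj hl0 fun i j hij ρ hρ h1 h2 h3 h4 =>
      disj_scale hα.1 hb0 hu huv hd hij hρ h1 h2 h3 h4)
    (r := r)
    (by
      rintro ⟨i, bi⟩
      have h1 := hRr i
      have h2 := hl0 i
      have h3 : (0:ℝ) ≤ r := by positivity
      cases bi <;> simp only [pLo, if_true, if_false, Bool.false_eq_true] <;> linarith)
    (A := fun n => Aset α x0 ((b * (n : ℝ)) ^ α⁻¹) u v)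
    (fun n => measurableSet_Aset _ _ _ _ _)
    (fun n hn x hx => by
      obtain ⟨_, i, _, h2⟩ := (hAiff n hn x).1 hx
      have h3 := div_le_div_of_nonneg_right (hRr i) (Nat.cast_nonneg (α := ℝ) n)
      linarith)
    (fun n hn => pieces_ae hl0 (by exact_mod_cast hn) (hAiff n hn))
    hX hB hs hst
  have e1 : ∑ i, (R i - l i) = PiAlpha α u v / b := by
    simp only [PiAlpha, hl, hR, Finset.sum_div, sub_div]
  have hfin : ∀ S : ℝ, -(t - s) * S = -((t - s) * I * (2 * (S / (2 * I)))) := by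
    intro S
    field_simp
  rw [pieces_sum, e1, hb, ← hfin] at this
  exact this
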